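/- arXiv:2405.16319 — 6 statements merged into one kernel-verified Lean document; each statement's English description precedes it below -/
import Mathlib

section
/- Assume (k, ℓ) is a complete Pick pair of positive kernels on a nonempty set X, and let z, w, v ∈ X be distinct points. If k(z,w) = 0, then ℓ(z,w) = 0, and moreover at least one of the following holds: (a) ℓ(z,v) = 0 and ℓ(w,v) = 0; or (b) k(z,v) = 0 or k(w,v) = 0. -/
open Matrix
open scoped ComplexOrder

noncomputable section

/-- `k` is a positive (semi-definite) kernel on `X`: every Gram sum is a nonnegative real
(using the partial order on `ℂ`, so `0 ≤ w` means `w` is real and nonnegative). -/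
def IsPosKernel {X : Type*} (k : X → X → ℂ) : Prop :=
  ∀ (n : ℕ) (z : Fin n → X) (c : Fin n → ℂ),
    0 ≤ ∑ i, ∑ j, (starRingEnd ℂ) (c i) * c j * k (z i) (z j)

/-- Positive semidefiniteness of the block matrix `[ℓ(z i, z j)·I − k(z i, z j)·W i (W j)ᴴ]`. -/
def PickBlockPSD {X : Type*} (k ℓ : X → X → ℂ) {n N : ℕ}
    (z : Fin n → X) (W : Fin n → Matrix (Fin N) (Fin N) ℂ) : Prop :=
  ∀ u : Fin n → (Fin N → ℂ),
    0 ≤ ∑ i, ∑ j,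
      star (u i) ⬝ᵥ ((ℓ (z i) (z j) • (1 : Matrix (Fin N) (Fin N) ℂ)
        - k (z i) (z j) • (W i * (W j)ᴴ)) *ᵥ u j)

/-- `Φ` is a contractive multiplier from `k` to `ℓ`. -/
def IsContractiveMultiplier {X : Type*} (k ℓ : X → X → ℂ) {N : ℕ}
    (Φ : X → Matrix (Fin N) (Fin N) ℂ) : Prop :=
  ∀ (n : ℕ) (z : Fin n → X), PickBlockPSD k ℓ z fun i => Φ (z i)

/-- `(k, ℓ)` is a complete Pick pair. -/
def IsCompletePickPair {X : Type*} (k ℓ : X → X → ℂ) : Prop :=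
  ∀ (n N : ℕ), 1 ≤ n → 1 ≤ N →
    ∀ (z : Fin n → X) (W : Fin n → Matrix (Fin N) (Fin N) ℂ),
      PickBlockPSD k ℓ z W →
      ∃ Φ : X → Matrix (Fin N) (Fin N) ℂ,
        IsContractiveMultiplier k ℓ Φ ∧ ∀ i, Φ (z i) = W i

theorem aux_herm (s p q r : ℂ) (h : ∀ α : ℂ, 0 ≤ (starRingEnd ℂ) α * p + α * q + α * (starRingEnd ℂ) α * s + r)
    (hs : s.im = 0) : q = (starRingEnd ℂ) p := by
  have h0 := (Complex.le_def.1 (h 0)).2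
  have h1 := (Complex.le_def.1 (h 1)).2
  have h2 := (Complex.le_def.1 (h Complex.I)).2
  simp at h0 h1 h2
  apply Complex.ext <;> simp <;> linarith

theorem aux_zero (p q r : ℂ) (h : ∀ α : ℂ, 0 ≤ (starRingEnd ℂ) α * p + α * q + r) : p = 0 := by
  have hq : q = (starRingEnd ℂ) p := aux_herm 0 p q r (by simpa using h) (by simp)
  subst hq
  by_contra hp
  have hn : 0 < Complex.normSq p := Complex.normSq_pos.2 hp
  have h0 := (Complex.le_def.1 (h 0)).1
  have h1 := (Complex.le_def.1 (h (-(((r.re + 1) / Complex.normSq p : ℝ) : ℂ) * p))).1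
  simp only [map_mul, map_neg, Complex.conj_ofReal, Complex.add_re, Complex.mul_re, Complex.neg_re,
    Complex.neg_im, Complex.mul_im, Complex.ofReal_re, Complex.ofReal_im, Complex.conj_re,
    Complex.conj_im, Complex.zero_re] at h1
  simp at h0
  have h2 : (r.re + 1) / Complex.normSq p * Complex.normSq p = r.re + 1 :=
    div_mul_cancel₀ _ hn.ne'
  generalize (r.re + 1) / Complex.normSq p = T at h1 h2
  rw [Complex.normSq_apply] at h2
  nlinarith

theorem kernel_herm {X : Type*} {k : X → X → ℂ} (hk : IsPosKernel k) (hkd : ∀ x, 0 < k x x)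
    (x y : X) : k y x = (starRingEnd ℂ) (k x y) := by
  refine aux_herm (k x x) _ _ (k y y) (fun α => ?_) (Complex.lt_def.1 (hkd x)).2.symm
  have := hk 2 ![x, y] ![α, 1]
  simp [Fin.sum_univ_two] at this
  convert this using 1
  ring

theorem mult_eq {X : Type*} {k ℓ : X → X → ℂ} {Φ : X → Matrix (Fin 1) (Fin 1) ℂ}
    (h : IsContractiveMultiplier k ℓ Φ) (x y : X)
    (hx : ℓ x x = k x x * (Φ x 0 0 * (starRingEnd ℂ) (Φ x 0 0))) :
    ℓ x y = k x y * (Φ x 0 0 * (starRingEnd ℂ) (Φ y 0 0)) := by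
  rw [← sub_eq_zero]
  refine aux_zero _ (ℓ y x - k y x * (Φ y 0 0 * (starRingEnd ℂ) (Φ x 0 0)))
    (ℓ y y - k y y * (Φ y 0 0 * (starRingEnd ℂ) (Φ y 0 0))) (fun α => ?_)
  have := h 2 ![x, y] ![![α], ![1]]
  simp [Fin.sum_univ_two, Matrix.mulVec, dotProduct, Matrix.mul_apply, hx] at this
  convert this using 1
  ring

theorem exists_root {a b : ℂ} (ha : 0 < a) (hb : 0 < b) :
    ∃ c : ℂ, c ≠ 0 ∧ b = a * (c * (starRingEnd ℂ) c) := by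
  obtain ⟨ha1, ha2⟩ := Complex.lt_def.1 ha
  obtain ⟨hb1, hb2⟩ := Complex.lt_def.1 hb
  simp at ha1 ha2 hb1 hb2
  have hab : 0 < b.re / a.re := div_pos hb1 ha1
  refine ⟨(Real.sqrt (b.re / a.re) : ℝ), ?_, ?_⟩
  · exact_mod_cast (Real.sqrt_pos.2 hab).ne'
  · rw [Complex.conj_ofReal, ← Complex.ofReal_mul, Real.mul_self_sqrt hab.le]
    apply Complex.ext
    · simp; field_simp
    · simp [← ha2, ← hb2]

theorem zero_of_zero {X : Type*} {k ℓ : X → X → ℂ}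
    (hkd : ∀ x, 0 < k x x) (hℓd : ∀ x, 0 < ℓ x x)
    (hCP : IsCompletePickPair k ℓ) (z w : X) (h0 : k z w = 0) : ℓ z w = 0 := by
  obtain ⟨c, -, hc⟩ := exists_root (hkd z) (hℓd z)
  obtain ⟨Φ, hΦ, hv⟩ := hCP 1 1 le_rfl le_rfl ![z] ![!![c]] (by
    intro u
    simp [Matrix.mulVec, dotProduct, Matrix.vecMul, hc])
  have hz : Φ z = !![c] := by simpa using hv 0
  have := mult_eq hΦ z w (by simpa [hz] using hc)
  simpa [h0] using this

/-- If `(k, ℓ)` is a complete Pick pair, `z, w, v` are distinct and `k(z,w) = 0`, then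
`ℓ(z,w) = 0` and moreover either `ℓ(z,v) = ℓ(w,v) = 0` or one of `k(z,v)`, `k(w,v)`
vanishes. -/
theorem completePick_zero_propagation {X : Type*} [Nonempty X] (k ℓ : X → X → ℂ)
    (hk : IsPosKernel k) (hℓ : IsPosKernel ℓ)
    (hkd : ∀ x, 0 < k x x) (hℓd : ∀ x, 0 < ℓ x x)
    (hCP : IsCompletePickPair k ℓ)
    (z w v : X) (hzw : z ≠ w) (hzv : z ≠ v) (hwv : w ≠ v)
    (h0 : k z w = 0) :
    ℓ z w = 0 ∧ ((ℓ z v = 0 ∧ ℓ w v = 0) ∨ (k z v = 0 ∨ k w v = 0)) := by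
  have hkwz : k w z = 0 := by rw [kernel_herm hk hkd z w, h0, map_zero]
  have h1 := zero_of_zero hkd hℓd hCP z w h0
  have h2 := zero_of_zero hkd hℓd hCP w z hkwz
  refine ⟨h1, ?_⟩
  by_contra hcon
  push Not at hcon
  obtain ⟨hne, hkz, hkw⟩ := hcon
  obtain ⟨a, ha0, ha⟩ := exists_root (hkd z) (hℓd z)
  obtain ⟨b, hb0, hb⟩ := exists_root (hkd w) (hℓd w)
  have key : ∀ s : ℂ, s * (starRingEnd ℂ) s = 1 →
      ∃ φ : ℂ, ℓ z v = k z v * (a * φ) ∧ ℓ w v = k w v * (s * b * φ) := by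
    intro s hs
    have hb' : ℓ w w = k w w * ((s * b) * (starRingEnd ℂ) (s * b)) := by
      rw [hb, map_mul]
      linear_combination (-(k w w * b * (starRingEnd ℂ) b)) * hs
    obtain ⟨Φ, hΦ, hv⟩ := hCP 2 1 (by norm_num) le_rfl ![z, w] ![!![a], !![s * b]] (by
      intro u
      have e1 : ℓ z z - k z z * (a * (starRingEnd ℂ) a) = 0 := sub_eq_zero.2 ha
      have e2 : ℓ w w - k w w * ((s * b) * (starRingEnd ℂ) (s * b)) = 0 := sub_eq_zero.2 hb'
      rw [map_mul] at e2
      simp [Fin.sum_univ_two, Matrix.mulVec, dotProduct, Matrix.mul_apply, h0, hkwz, h1, h2]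
      rw [e1, e2]
      simp)
    have hz : Φ z = !![a] := by simpa using hv 0
    have hw : Φ w = !![s * b] := by simpa using hv 1
    refine ⟨(starRingEnd ℂ) (Φ v 0 0), ?_, ?_⟩
    · have := mult_eq hΦ z v (by simpa [hz] using ha)
      simpa [hz] using this
    · have := mult_eq hΦ w v (by rw [hw]; exact hb')
      rw [hw] at this
      exact this
  obtain ⟨φ, p1, p2⟩ := key 1 (by simp)
  obtain ⟨ψ, q1, q2⟩ := key (-1) (by simp)
  have e1 : φ = ψ := by
    have : k z v * a * φ = k z v * a * ψ := by linear_combination q1 - p1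
    exact mul_left_cancel₀ (mul_ne_zero hkz ha0) this
  have e2 : φ = -ψ := by
    have : k w v * b * φ = k w v * b * (-ψ) := by linear_combination q2 - p2
    exact mul_left_cancel₀ (mul_ne_zero hkw hb0) this
  have e3 : φ = 0 := by linear_combination (e1 + e2) / 2
  subst e3
  exact hne (by simpa using p1) (by simpa using p2)
end
end

section
/- Let k be a positive kernel on a nonempty set X with k(z,w) ≠ 0 for all z, w ∈ X. If B is a positive kernel on X such that the function (z,w) ↦ (1 − B(z,w))·k(z,w) is a positive kernel, then either |B(z,w)| < 1 for all z, w ∈ X, or B(z,w) = 1 for all z, w ∈ X. -/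
open Matrix
open scoped ComplexOrder

noncomputable section

theorem posK_diag {X : Type*} {K : X → X → ℂ} (h : IsPosKernel K) (z : X) :
    0 ≤ (K z z).re ∧ (K z z).im = 0 := by
  have := h 1 (fun _ => z) (fun _ => 1)
  simp [Complex.le_def] at this
  exact ⟨this.1, this.2.symm⟩

theorem posK_cs {X : Type*} {K : X → X → ℂ} (h : IsPosKernel K) (z w : X) :
    Complex.normSq (K z w) ≤ (K z z).re * (K w w).re := by
  obtain ⟨ha, ha'⟩ := posK_diag h z
  obtain ⟨hd, hd'⟩ := posK_diag h w
  have key : ∀ s t : ℂ, 0 ≤ (starRingEnd ℂ) s * s * K z z + (starRingEnd ℂ) s * t * K z w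
      + ((starRingEnd ℂ) t * s * K w z + (starRingEnd ℂ) t * t * K w w) := by
    intro s t
    have := h 2 ![z, w] ![s, t]
    simpa [Fin.sum_univ_two] using this
  have h1 := (key 1 1)
  have h2 := (key 1 Complex.I)
  simp [Complex.le_def, ha', hd'] at h1 h2
  have key2 : ∀ x y : ℝ, 0 ≤ x ^ 2 * (K z z).re + 2 * x * y * Complex.normSq (K z w)
      + y ^ 2 * Complex.normSq (K z w) * (K w w).re := by
    intro x y
    have := (Complex.le_def.1 (key x ((starRingEnd ℂ) (K z w) * y))).1
    have e1 : (K w z).re = (K z w).re := by linarith [h2.2]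
    have e2 : (K w z).im = -(K z w).im := by linarith [h1.2]
    simp [ha', hd', e1, e2] at this
    rw [Complex.normSq_apply]
    nlinarith [this]
  have hn := Complex.normSq_nonneg (K z w)
  generalize Complex.normSq (K z w) = b at *
  generalize (K z z).re = a at *
  generalize (K w w).re = d at *
  rcases hn.eq_or_lt with hb | hb
  · rw [← hb]; positivity
  rcases ha.eq_or_lt with h0 | h0
  · have := key2 (-(d + 1)) 1
    rw [← h0] at this
    nlinarith [mul_nonneg hb.le hd]
  · have := key2 (-b) a
    have h3 : 0 ≤ (a * b) * (a * d - b) := by nlinarith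
    have := nonneg_of_mul_nonneg_right h3 (mul_pos h0 hb)
    linarith

/-- Maximum modulus principle for kernels: if `k` is a non-vanishing positive kernel and
`B` is a positive kernel with `(1 − B)·k` a positive kernel, then either `|B| < 1`
everywhere or `B ≡ 1`. -/
theorem kernel_maximum_modulus {X : Type*} [Nonempty X] (k B : X → X → ℂ)
    (hk : IsPosKernel k) (hknv : ∀ z w, k z w ≠ 0)
    (hB : IsPosKernel B)
    (hBk : IsPosKernel (fun z w => (1 - B z w) * k z w)) :
    (∀ z w, ‖B z w‖ < 1) ∨ (∀ z w, B z w = 1) := by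
  have kd : ∀ z, 0 < (k z z).re := fun z => by
    obtain ⟨h1, h2⟩ := posK_diag hk z
    rcases h1.eq_or_lt with h | h
    · exact absurd (Complex.ext h.symm h2) (hknv z z)
    · exact h
  have Bd : ∀ z, (B z z).re ≤ 1 := fun z => by
    have h1 := (posK_diag hBk z).1
    have h2 := (posK_diag hk z).2
    simp [h2] at h1
    have := nonneg_of_mul_nonneg_left h1 (kd z)
    linarith
  have B0 : ∀ z, 0 ≤ (B z z).re := fun z => (posK_diag hB z).1
  have step : ∀ z, (B z z).re = 1 → ∀ w, B z w = 1 := fun z hz w => by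
    have h1 := posK_cs hBk z w
    have h2 : (1 - B z z) * k z z = 0 := by
      have : B z z = 1 := Complex.ext hz (posK_diag hB z).2
      rw [this]; simp
    simp only [h2, Complex.zero_re, zero_mul] at h1
    have h3 := Complex.normSq_eq_zero.1 (le_antisymm h1 (Complex.normSq_nonneg _))
    have h4 := (mul_eq_zero.1 h3).resolve_right (hknv z w)
    exact (sub_eq_zero.1 h4).symm
  by_cases hall : ∀ z w, ‖B z w‖ < 1
  · exact Or.inl hall
  right
  push Not at hall
  obtain ⟨z, w, hzw⟩ := hall
  have h1 := posK_cs hB z w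
  rw [Complex.normSq_eq_norm_sq] at h1
  have hz : (B z z).re = 1 := by
    nlinarith [Bd z, Bd w, B0 z, B0 w]
  intro u v
  apply step
  have h2 := posK_cs hB z u
  rw [step z hz u, hz] at h2
  simp at h2
  exact le_antisymm (Bd u) h2
end
end

section
/- Assume (k, ℓ) is a complete Pick pair of positive kernels on a nonempty set X, n ≥ 2, and z₁,…,zₙ are distinct points of X. Write ℓ_z for the function x ↦ ℓ(x,z) and k_z for x ↦ k(x,z). Suppose the functions ℓ_{z₁},…,ℓ_{z_{n−1}} are linearly independent and there exist scalars c₁,…,c_{n−1} ∈ ℂ with ℓ_{zₙ}(x) = Σ_{i=1}^{n−1} c_i·ℓ_{z_i}(x) for all x ∈ X. Then for every index j with 1 ≤ j ≤ n−1 and c_j ≠ 0, the functions k_{zₙ} and k_{z_j} are linearly dependent. -/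
open Matrix
open scoped ComplexOrder

noncomputable section

lemma IsPosKernel.herm {X : Type*} {k : X → X → ℂ} (hk : IsPosKernel k) (x y : X) :
    (starRingEnd ℂ) (k y x) = k x y := by
  have h1 := (Complex.le_def.1 (hk 2 ![x, y] ![1, 1])).2
  have h2 := (Complex.le_def.1 (hk 2 ![x, y] ![1, Complex.I])).2
  have h3 := (Complex.le_def.1 (hk 1 ![x] ![1])).2
  have h4 := (Complex.le_def.1 (hk 1 ![y] ![1])).2
  simp [Fin.sum_univ_two] at h1 h2 h3 h4
  apply Complex.ext
  · simp; linarith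
  · simp; linarith

lemma quad_eq {X : Type*} (k : X → X → ℂ) {n : ℕ} (z : Fin n → X) (c : Fin n → ℂ) :
    star c ⬝ᵥ ((Matrix.of fun i j => k (z i) (z j)) *ᵥ c) =
      ∑ i, ∑ j, (starRingEnd ℂ) (c i) * c j * k (z i) (z j) := by
  simp only [dotProduct, mulVec, Finset.mul_sum, Matrix.of_apply, Pi.star_apply]
  refine Finset.sum_congr rfl fun i _ => Finset.sum_congr rfl fun j _ => ?_
  rw [starRingEnd_apply]; ring

lemma IsPosKernel.psd {X : Type*} {k : X → X → ℂ} (hk : IsPosKernel k) {n : ℕ}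
    (z : Fin n → X) : (Matrix.of fun i j => k (z i) (z j)).PosSemidef := by
  refine Matrix.PosSemidef.of_dotProduct_mulVec_nonneg ?_ ?_
  · ext i j
    simpa [Matrix.conjTranspose_apply] using hk.herm (z i) (z j)
  · intro c
    rw [quad_eq]
    exact hk n z c

lemma IsPosKernel.null {X : Type*} {k : X → X → ℂ} (hk : IsPosKernel k) {n : ℕ}
    (z : Fin n → X) (c : Fin n → ℂ)
    (h : ∑ i, ∑ j, (starRingEnd ℂ) (c i) * c j * k (z i) (z j) = 0) (x : X) :
    ∑ j, c j * k x (z j) = 0 := by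
  have hp := hk.psd (Fin.cons x z : Fin (n + 1) → X)
  have h0 := (hp.dotProduct_mulVec_zero_iff (Fin.cons 0 c : Fin (n + 1) → ℂ)).1 (by
    rw [quad_eq]
    simpa [Fin.sum_univ_succ] using h)
  have h1 := congrFun h0 0
  simp [mulVec, dotProduct, Fin.sum_univ_succ] at h1
  rw [← h1]
  exact Finset.sum_congr rfl fun j _ => mul_comm _ _

lemma pick_scalar {X : Type*} (k ℓ : X → X → ℂ) {n : ℕ}
    (z : Fin n → X) (W : Fin n → Matrix (Fin 1) (Fin 1) ℂ) (u : Fin n → Fin 1 → ℂ) :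
    (∑ i, ∑ j,
      star (u i) ⬝ᵥ ((ℓ (z i) (z j) • (1 : Matrix (Fin 1) (Fin 1) ℂ)
        - k (z i) (z j) • (W i * (W j)ᴴ)) *ᵥ u j)) =
    (∑ i, ∑ j, (starRingEnd ℂ) (u i 0) * u j 0 * ℓ (z i) (z j)) -
    ∑ i, ∑ j, (starRingEnd ℂ) (u i 0 * (starRingEnd ℂ) (W i 0 0)) *
      (u j 0 * (starRingEnd ℂ) (W j 0 0)) * k (z i) (z j) := by
  simp only [← Finset.sum_sub_distrib]
  refine Finset.sum_congr rfl fun i _ => Finset.sum_congr rfl fun j _ => ?_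
  simp [dotProduct, mulVec, Matrix.mul_apply]
  ring

lemma lower_bound {X : Type*} {ℓ : X → X → ℂ} (hℓ : IsPosKernel ℓ) {m : ℕ}
    (z : Fin (m + 1) → X)
    (hind : LinearIndependent ℂ (fun i : Fin (m + 1) => fun x : X => ℓ x (z i))) :
    ∃ δ : ℝ, 0 < δ ∧ ∀ (u : Fin (m + 1) → ℂ) (j : Fin (m + 1)),
      δ * ‖u j‖ ^ 2 ≤ (∑ i, ∑ j, (starRingEnd ℂ) (u i) * u j * ℓ (z i) (z j)).re := by
  set f : (Fin (m + 1) → ℂ) → ℝ := fun u =>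
    (∑ i, ∑ j, (starRingEnd ℂ) (u i) * u j * ℓ (z i) (z j)).re with hf
  have hc : Continuous f := by
    rw [hf]
    refine Complex.continuous_re.comp ?_
    refine continuous_finsetSum _ fun i _ => continuous_finsetSum _ fun j _ => ?_
    exact ((Complex.continuous_conj.comp (continuous_apply i)).mul (continuous_apply j)).mul
      continuous_const
  have hnn : ∀ u, 0 ≤ f u := fun u => (Complex.le_def.1 (hℓ _ z u)).1
  have hpos : ∀ u, u ≠ 0 → 0 < f u := by
    intro u hu
    refine lt_of_le_of_ne (hnn u) fun h0 => hu ?_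
    have h := hℓ.null z u (Complex.ext h0.symm (Complex.le_def.1 (hℓ _ z u)).2.symm)
    rw [Fintype.linearIndependent_iff] at hind
    funext i
    refine hind u ?_ i
    funext x
    simpa using h x
  obtain ⟨s, hs, hmin⟩ := (isCompact_sphere (0 : Fin (m + 1) → ℂ) 1).exists_isMinOn
    (NormedSpace.sphere_nonempty.2 zero_le_one) hc.continuousOn
  have hs0 : s ≠ 0 := by
    rintro rfl
    simp at hs
  refine ⟨f s, hpos s hs0, fun u j => ?_⟩
  change _ ≤ f u
  by_cases hu : u = 0
  · subst hu
    simpa using hnn 0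
  have hn : 0 < ‖u‖ := norm_pos_iff.2 hu
  have hle : f s ≤ f (((‖u‖⁻¹ : ℝ) : ℂ) • u) := hmin (by
    simp [norm_smul, hn.ne'])
  have hhom : f (((‖u‖⁻¹ : ℝ) : ℂ) • u) = ‖u‖⁻¹ ^ 2 * f u := by
    rw [hf]
    simp only
    rw [← Complex.re_ofReal_mul, Finset.mul_sum]
    congr 1
    refine Finset.sum_congr rfl fun i _ => ?_
    rw [Finset.mul_sum]
    refine Finset.sum_congr rfl fun j _ => ?_
    simp only [Pi.smul_apply, smul_eq_mul, map_mul, Complex.conj_ofReal]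
    push_cast
    ring
  rw [hhom] at hle
  have h2 : ‖u j‖ ^ 2 ≤ ‖u‖ ^ 2 := by
    gcongr
    exact norm_le_pi_norm u j
  calc f s * ‖u j‖ ^ 2 ≤ f s * ‖u‖ ^ 2 := mul_le_mul_of_nonneg_left h2 (hnn s)
    _ ≤ (‖u‖⁻¹ ^ 2 * f u) * ‖u‖ ^ 2 := by gcongr
    _ = f u := by field_simp


/-- Lemma on linear dependence: if `(k, ℓ)` is a complete Pick pair, `z 0, …, z (m+1)` are
`m + 2 ≥ 2` distinct points, the functions `ℓ_{z 0}, …, ℓ_{z m}` are linearly independent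
and `ℓ_{z (m+1)} = Σ_{i ≤ m} c i · ℓ_{z i}`, then for every `j` with `c j ≠ 0` the
functions `k_{z (m+1)}` and `k_{z j}` are linearly dependent. -/
theorem completePick_linear_dependence {X : Type*} [Nonempty X] (k ℓ : X → X → ℂ)
    (hk : IsPosKernel k) (hℓ : IsPosKernel ℓ)
    (hkd : ∀ x, 0 < k x x) (hℓd : ∀ x, 0 < ℓ x x)
    (hCP : IsCompletePickPair k ℓ)
    (m : ℕ) (z : Fin (m + 2) → X) (hz : Function.Injective z)
    (hind : LinearIndependent ℂ (fun i : Fin (m + 1) => fun x : X => ℓ x (z i.castSucc)))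
    (c : Fin (m + 1) → ℂ)
    (hdep : ∀ x : X, ℓ x (z (Fin.last (m + 1))) = ∑ i, c i * ℓ x (z i.castSucc)) :
    ∀ j : Fin (m + 1), c j ≠ 0 →
      ∃ α β : ℂ, ¬(α = 0 ∧ β = 0) ∧
        ∀ x : X, α * k x (z (Fin.last (m + 1))) + β * k x (z j.castSucc) = 0 := by
  intro j hj
  obtain ⟨δ, hδ, hlow⟩ := lower_bound hℓ (fun i : Fin (m + 1) => z i.castSucc) hind
  have hkj := Complex.pos_iff.1 (hkd (z j.castSucc))
  set κ : ℝ := (k (z j.castSucc) (z j.castSucc)).re with hκ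
  have hkκ : k (z j.castSucc) (z j.castSucc) = (κ : ℂ) :=
    Complex.ext (by simp [hκ]) (by simp [← hkj.2])
  set w : ℝ := Real.sqrt (δ / κ) with hw
  have hw0 : 0 < w := Real.sqrt_pos.2 (div_pos hδ hkj.1)
  have hww : w * w * κ = δ := by
    rw [hw, Real.mul_self_sqrt (div_pos hδ hkj.1).le, div_mul_cancel₀ _ hkj.1.ne']
  obtain ⟨Φ, hΦ, hΦW⟩ := hCP (m + 1) 1 (by omega) le_rfl (fun i => z i.castSucc)
    (fun i => Matrix.of fun _ _ => if i = j then (w : ℂ) else 0) (by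
      intro u
      rw [pick_scalar]
      have h1 := hlow (fun i => u i 0) j
      have h2 := hℓ (m + 1) (fun i => z i.castSucc) (fun i => u i 0)
      have h3 : (∑ i, ∑ i', (starRingEnd ℂ) (u i 0 * (starRingEnd ℂ)
          ((Matrix.of fun _ _ => if i = j then (w : ℂ) else 0 : Matrix (Fin 1) (Fin 1) ℂ) 0 0)) *
          (u i' 0 * (starRingEnd ℂ)
          ((Matrix.of fun _ _ => if i' = j then (w : ℂ) else 0 : Matrix (Fin 1) (Fin 1) ℂ) 0 0)) *
          k (z i.castSucc) (z i'.castSucc)) = ((δ * ‖u j 0‖ ^ 2 : ℝ) : ℂ) := by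
        rw [Finset.sum_eq_single j, Finset.sum_eq_single j]
        · simp only [Matrix.of_apply, if_true, map_mul, Complex.conj_ofReal, hkκ]
          rw [← hww]
          push_cast
          rw [← Complex.conj_mul']
          ring
        · intro b _ hb
          simp [hb]
        · simp
        · intro b _ hb
          simp [hb]
        · simp
      rw [h3, sub_nonneg]
      rw [Complex.le_def] at h2 ⊢
      refine ⟨?_, ?_⟩
      · rw [Complex.ofReal_re]; exact h1
      · rw [Complex.ofReal_im]; exact h2.2)
  set v : Fin (m + 2) → ℂ := Fin.snoc c (-1) with hv
  have hvl : ∀ x, ∑ i, v i * ℓ x (z i) = 0 := by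
    intro x
    rw [Fin.sum_univ_castSucc, hdep x]
    simp [hv]
  have hℓ0 : ∑ i, ∑ i', (starRingEnd ℂ) (v i) * v i' * ℓ (z i) (z i') = 0 := by
    refine Finset.sum_eq_zero fun i _ => ?_
    simp only [mul_assoc, ← Finset.mul_sum, hvl, mul_zero]
  have hP := hΦ (m + 2) z (fun i _ => v i)
  rw [pick_scalar, hℓ0, zero_sub, neg_nonneg] at hP
  have hnull := hk.null z (fun i => v i * (starRingEnd ℂ) (Φ (z i) 0 0))
    (le_antisymm hP (hk _ z _))
  refine ⟨-(starRingEnd ℂ) (Φ (z (Fin.last (m + 1))) 0 0), c j * w, ?_, fun x => ?_⟩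
  · rintro ⟨-, h⟩
    rcases mul_eq_zero.1 h with h | h
    · exact hj h
    · exact hw0.ne' (Complex.ofReal_eq_zero.1 h)
  · have h := hnull x
    rw [Fin.sum_univ_castSucc, Finset.sum_eq_single j] at h
    · simp only [hΦW, hv, Fin.snoc_castSucc, Fin.snoc_last, Matrix.of_apply, if_true,
        Complex.conj_ofReal] at h
      linear_combination h
    · intro b _ hb
      simp [hΦW, hb]
    · simp
end
end

section
/- Let k and ℓ be normalized diagonal holomorphic kernels with coefficients (k_a) and (ℓ_a), a ∈ ℕ^𝗀. Suppose there exist nonnegative real numbers t_a (for a ≠ 0), g_a and h_a (for all a) with g_0 = 1 and h_0 = 0, such that for every a ∈ ℕ^𝗀 with |a| > 0: ℓ_a = g_a + Σ_{0 < u ≤ a} t_u·ℓ_{a−u} and k_a + h_a = Σ_{0 < u ≤ a} t_u·k_{a−u}. Then (k, ℓ) is a complete Carathéodory pair. -/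
open Matrix
open scoped ComplexOrder

noncomputable section
open scoped Classical

/-- The monomial `z^a = ∏ i, (z i)^(a i)` for a multi-index `a ∈ ℕ^𝗀`. -/
def mpow {g : ℕ} (z : Fin g → ℂ) (a : Fin g → ℕ) : ℂ := ∏ i, z i ^ a i

/-- The diagonal kernel `k(z,w) = Σ_a k_a · z^a · conj (w^a)` with coefficients `kc`. -/
def diagKer {g : ℕ} (kc : (Fin g → ℕ) → ℝ) (z w : Fin g → ℂ) : ℂ :=
  ∑' a : Fin g → ℕ, (kc a : ℂ) * mpow z a * (starRingEnd ℂ) (mpow w a)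

/-- `kc` is the coefficient family of a normalized diagonal holomorphic kernel on `Ω`:
`k_0 = 1`, `k_a > 0`, and `Σ_a k_a·|x^a|² < ∞` for every `x ∈ Ω`. -/
def IsNormalizedDiag {g : ℕ} (Ω : Set (Fin g → ℂ)) (kc : (Fin g → ℕ) → ℝ) : Prop :=
  kc 0 = 1 ∧ (∀ a, 0 < kc a) ∧
    ∀ x ∈ Ω, Summable fun a : Fin g → ℕ => kc a * ‖mpow x a‖ ^ 2

/-- `F ⊆ ℕ^𝗀` is co-invariant: `b ∈ F` and `a ≤ b` imply `a ∈ F`. -/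
def IsCoinvariant {g : ℕ} (F : Finset (Fin g → ℕ)) : Prop :=
  ∀ b ∈ F, ∀ a : Fin g → ℕ, a ≤ b → a ∈ F

/-- The Carathéodory block matrix `C(S)` associated with coefficient families `kc, ℓc`
and matrix coefficients `c`: the `(a,b)` block is `√(k_a/ℓ_b)·c_{b−a}` when `a ≤ b` and
`0` otherwise. -/
def caraMatrix {g : ℕ} (kc ℓc : (Fin g → ℕ) → ℝ) {J : ℕ}
    (c : (Fin g → ℕ) → Matrix (Fin J) (Fin J) ℂ) (S : Finset (Fin g → ℕ)) :
    Matrix (S × Fin J) (S × Fin J) ℂ :=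
  fun p q =>
    if (p.1 : Fin g → ℕ) ≤ (q.1 : Fin g → ℕ)
    then (Real.sqrt (kc p.1 / ℓc q.1) : ℂ) * c ((q.1 : Fin g → ℕ) - (p.1 : Fin g → ℕ)) p.2 q.2
    else 0

/-- A (complex) square matrix is a contraction when `I − CᴴC` is positive semidefinite. -/
def IsContractionMat {ι : Type*} [Fintype ι] [DecidableEq ι] (C : Matrix ι ι ℂ) : Prop :=
  ((1 : Matrix ι ι ℂ) - Cᴴ * C).PosSemidef

/-- `(kc, ℓc)` is a complete Carathéodory pair: every contractive Carathéodory data on a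
finite co-invariant set `F` extends to all of `ℕ^𝗀` with all finite sections contractive. -/
def IsCCPair {g : ℕ} (kc ℓc : (Fin g → ℕ) → ℝ) : Prop :=
  ∀ J : ℕ, 1 ≤ J → ∀ F : Finset (Fin g → ℕ), IsCoinvariant F →
    ∀ c₀ : (Fin g → ℕ) → Matrix (Fin J) (Fin J) ℂ,
      IsContractionMat (caraMatrix kc ℓc c₀ F) →
      ∃ c : (Fin g → ℕ) → Matrix (Fin J) (Fin J) ℂ,
        (∀ a ∈ F, c a = c₀ a) ∧
        ∀ S : Finset (Fin g → ℕ), IsContractionMat (caraMatrix kc ℓc c S)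

theorem contr_ext {V H E : Type*} [AddCommGroup V] [Module ℂ V]
    [NormedAddCommGroup H] [InnerProductSpace ℂ H] [FiniteDimensional ℂ H]
    [NormedAddCommGroup E] [InnerProductSpace ℂ E]
    (W : Submodule ℂ V) (M : V →ₗ[ℂ] H) (R : V →ₗ[ℂ] E)
    (hR : ∀ w ∈ W, ‖R w‖ ≤ ‖M w‖) :
    ∃ R' : V →ₗ[ℂ] E, (∀ w ∈ W, R' w = R w) ∧ ∀ v, ‖R' v‖ ≤ ‖M v‖ := by
  let MW := (M.domRestrict W).rangeRestrict
  obtain ⟨s, hs⟩ := LinearMap.exists_rightInverse_of_surjective MW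
    (LinearMap.range_rangeRestrict _)
  let U := LinearMap.range (M.domRestrict W)
  have hs' : ∀ u : U, M (s u : V) = u := fun u => by
    have := LinearMap.congr_fun hs u
    exact congrArg Subtype.val this
  let P : H →ₗ[ℂ] U := (U.orthogonalProjectionOnto : H →L[ℂ] U).toLinearMap
  refine ⟨R ∘ₗ W.subtype ∘ₗ s ∘ₗ P ∘ₗ M, ?_, ?_⟩
  · intro w hw
    have hm : M w ∈ U := ⟨⟨w, hw⟩, rfl⟩
    have hP : P (M w) = ⟨M w, hm⟩ :=
      Submodule.orthogonalProjectionOnto_mem_subspace_eq_self (K := U) ⟨M w, hm⟩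
    have h1 : ‖R ((s (P (M w)) : V) - w)‖ ≤ 0 := by
      refine (hR _ (W.sub_mem (s _).2 hw)).trans ?_
      rw [map_sub, hs', hP]; simp
    have h2 := norm_le_zero_iff.1 h1
    rw [map_sub, sub_eq_zero] at h2
    exact h2
  · intro v
    refine (hR _ (s (P (M v))).2).trans ?_
    rw [hs']
    exact U.norm_orthogonalProjectionOnto_apply_le (M v)

def sqn {J : ℕ} (v : Fin J → ℂ) : ℝ := ∑ j, ‖v j‖ ^ 2

def cx {g J : ℕ} (c : (Fin g → ℕ) → Matrix (Fin J) (Fin J) ℂ) (F : Finset (Fin g → ℕ))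
    (x : (Fin g → ℕ) → Fin J → ℂ) (a : Fin g → ℕ) : Fin J → ℂ :=
  ∑ b ∈ F, if a ≤ b then c (b - a) *ᵥ x b else 0

def Good {g J : ℕ} (kc ℓc : (Fin g → ℕ) → ℝ) (c : (Fin g → ℕ) → Matrix (Fin J) (Fin J) ℂ)
    (F : Finset (Fin g → ℕ)) : Prop :=
  ∀ x : (Fin g → ℕ) → Fin J → ℂ,
    ∑ a ∈ F, kc a * sqn (cx c F x a) ≤ ∑ b ∈ F, ℓc b * sqn (x b)

theorem star_dot {n : Type*} [Fintype n] (v : n → ℂ) :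
    star v ⬝ᵥ v = ((∑ i, ‖v i‖ ^ 2 : ℝ) : ℂ) := by
  simp only [dotProduct, Pi.star_apply, RCLike.star_def, Complex.conj_mul']
  push_cast; rfl

theorem quad_aux {n : Type*} [Fintype n] [DecidableEq n] (C : Matrix n n ℂ) (v : n → ℂ) :
    star v ⬝ᵥ ((1 - Cᴴ * C) *ᵥ v) =
      ((∑ i, ‖v i‖ ^ 2 - ∑ i, ‖(C *ᵥ v) i‖ ^ 2 : ℝ) : ℂ) := by
  rw [Matrix.sub_mulVec, Matrix.one_mulVec, dotProduct_sub, star_dot, ← Matrix.mulVec_mulVec,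
    Matrix.dotProduct_mulVec, ← Matrix.star_mulVec, star_dot]
  push_cast; rfl

def scl {g J : ℕ} (ℓc : (Fin g → ℕ) → ℝ) (F : Finset (Fin g → ℕ))
    (x : (Fin g → ℕ) → Fin J → ℂ) : (F × Fin J) → ℂ :=
  fun p => (Real.sqrt (ℓc p.1) : ℂ) * x p.1 p.2

theorem scl_sum {g J : ℕ} (ℓc : (Fin g → ℕ) → ℝ) (hℓ : ∀ a, 0 ≤ ℓc a)
    (F : Finset (Fin g → ℕ)) (x : (Fin g → ℕ) → Fin J → ℂ) :
    ∑ i, ‖scl ℓc F x i‖ ^ 2 = ∑ b ∈ F, ℓc b * sqn (x b) := by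
  rw [Fintype.sum_prod_type, ← Finset.sum_coe_sort F]
  refine Finset.sum_congr rfl fun b _ => ?_
  rw [sqn, Finset.mul_sum]
  refine Finset.sum_congr rfl fun j _ => ?_
  simp only [scl, norm_mul, mul_pow, Complex.norm_real, Real.norm_eq_abs, sq_abs]
  rw [Real.sq_sqrt (hℓ _)]

theorem cara_scl {g J : ℕ} (kc ℓc : (Fin g → ℕ) → ℝ) (hk : ∀ a, 0 ≤ kc a) (hℓ : ∀ a, 0 < ℓc a)
    (c : (Fin g → ℕ) → Matrix (Fin J) (Fin J) ℂ)
    (F : Finset (Fin g → ℕ)) (x : (Fin g → ℕ) → Fin J → ℂ) :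
    caraMatrix kc ℓc c F *ᵥ scl ℓc F x = scl kc F (cx c F x) := by
  ext ⟨a, i⟩
  simp only [Matrix.mulVec, dotProduct, Fintype.sum_prod_type, scl, cx]
  rw [← Finset.sum_coe_sort F, Finset.sum_apply, Finset.mul_sum]
  refine Finset.sum_congr rfl fun b _ => ?_
  simp only [caraMatrix]
  split_ifs with h
  · simp only [Matrix.mulVec, dotProduct, Finset.mul_sum]
    refine Finset.sum_congr rfl fun j _ => ?_
    have : (Real.sqrt (kc a / ℓc b) : ℂ) * (Real.sqrt (ℓc b) : ℂ) = (Real.sqrt (kc a) : ℂ) := by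
      rw [← Complex.ofReal_mul, ← Real.sqrt_mul (div_nonneg (hk _) (hℓ _).le),
        div_mul_cancel₀ _ (hℓ _).ne']
    rw [← this]; ring
  · simp

theorem quad_eq_s14 {g J : ℕ} (kc ℓc : (Fin g → ℕ) → ℝ) (hk : ∀ a, 0 ≤ kc a) (hℓ : ∀ a, 0 < ℓc a)
    (c : (Fin g → ℕ) → Matrix (Fin J) (Fin J) ℂ)
    (F : Finset (Fin g → ℕ)) (x : (Fin g → ℕ) → Fin J → ℂ) :
    star (scl ℓc F x) ⬝ᵥ ((1 - (caraMatrix kc ℓc c F)ᴴ * caraMatrix kc ℓc c F) *ᵥ scl ℓc F x) =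
      ((∑ b ∈ F, ℓc b * sqn (x b) - ∑ a ∈ F, kc a * sqn (cx c F x a) : ℝ) : ℂ) := by
  rw [quad_aux, scl_sum _ (fun a => (hℓ a).le), cara_scl _ _ hk hℓ, scl_sum _ hk]

theorem scl_surj {g J : ℕ} (ℓc : (Fin g → ℕ) → ℝ) (hℓ : ∀ a, 0 < ℓc a)
    (F : Finset (Fin g → ℕ)) (v : (F × Fin J) → ℂ) : ∃ x, scl ℓc F x = v := by
  refine ⟨fun b j => if h : b ∈ F then v (⟨b, h⟩, j) / (Real.sqrt (ℓc b) : ℂ) else 0, ?_⟩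
  ext ⟨⟨b, hb⟩, j⟩
  have : (Real.sqrt (ℓc b) : ℂ) ≠ 0 := by
    exact_mod_cast (Real.sqrt_pos.2 (hℓ b)).ne'
  simp only [scl, hb, dif_pos]
  field_simp

theorem good_iff {g J : ℕ} (kc ℓc : (Fin g → ℕ) → ℝ) (hk : ∀ a, 0 ≤ kc a) (hℓ : ∀ a, 0 < ℓc a)
    (c : (Fin g → ℕ) → Matrix (Fin J) (Fin J) ℂ) (F : Finset (Fin g → ℕ)) :
    IsContractionMat (caraMatrix kc ℓc c F) ↔ Good kc ℓc c F := by
  constructor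
  · intro h x
    have := h.dotProduct_mulVec_nonneg (scl ℓc F x)
    rw [quad_eq_s14 _ _ hk hℓ] at this
    have h2 := Complex.zero_le_real.1 this
    linarith
  · intro h
    refine Matrix.PosSemidef.of_dotProduct_mulVec_nonneg ?_ ?_
    · exact Matrix.isHermitian_one.sub (Matrix.isHermitian_conjTranspose_mul_self _)
    · intro v
      obtain ⟨x, rfl⟩ := scl_surj ℓc hℓ F v
      rw [quad_eq_s14 _ _ hk hℓ]
      exact Complex.zero_le_real.2 (sub_nonneg.2 (h x))

theorem good_factor {g J : ℕ} (kc ℓc : (Fin g → ℕ) → ℝ) (hk : ∀ a, 0 ≤ kc a)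
    (hℓ : ∀ a, 0 < ℓc a)
    (c : (Fin g → ℕ) → Matrix (Fin J) (Fin J) ℂ) (F : Finset (Fin g → ℕ))
    (h : Good kc ℓc c F) :
    ∃ M : ((Fin g → ℕ) → Fin J → ℂ) →ₗ[ℂ] EuclideanSpace ℂ (F × Fin J), ∀ x,
      ‖M x‖ ^ 2 = ∑ b ∈ F, ℓc b * sqn (x b) - ∑ a ∈ F, kc a * sqn (cx c F x a) := by
  have h1 := (good_iff kc ℓc hk hℓ c F).2 h
  obtain ⟨B, hB⟩ : ∃ B : Matrix (F × Fin J) (F × Fin J) ℂ,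
      (1 - (caraMatrix kc ℓc c F)ᴴ * caraMatrix kc ℓc c F) = Bᴴ * B := by
    open scoped MatrixOrder in
    obtain ⟨B, hB⟩ := CStarAlgebra.nonneg_iff_eq_star_mul_self.1 h1.nonneg
    exact ⟨B, hB⟩
  let S : ((Fin g → ℕ) → Fin J → ℂ) →ₗ[ℂ] (F × Fin J → ℂ) :=
    { toFun := scl ℓc F
      map_add' := by intro x y; ext p; simp [scl, mul_add]
      map_smul' := by intro r x; ext p; simp [scl]; ring }
  refine ⟨(WithLp.linearEquiv 2 ℂ (F × Fin J → ℂ)).symm.toLinearMap ∘ₗ B.mulVecLin ∘ₗ S, ?_⟩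
  intro x
  rw [EuclideanSpace.norm_sq_eq]
  have h2 := quad_eq_s14 kc ℓc hk hℓ c F x
  rw [hB, ← Matrix.mulVec_mulVec, Matrix.dotProduct_mulVec, ← Matrix.star_mulVec, star_dot] at h2
  exact Complex.ofReal_injective h2

theorem sqn_nonneg {J : ℕ} (v : Fin J → ℂ) : 0 ≤ sqn v :=
  Finset.sum_nonneg fun _ _ => by positivity

theorem sqn_zero {J : ℕ} : sqn (0 : Fin J → ℂ) = 0 := by simp [sqn]

theorem shift_sum {g : ℕ} {A : Type*} [AddCommMonoid A] (F F' : Finset (Fin g → ℕ))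
    (u : Fin g → ℕ) (H : ∀ d, d + u ∈ F' → d ∈ F) (f : (Fin g → ℕ) → A) :
    (∑ a ∈ F', if u ≤ a then f a else 0) = ∑ d ∈ F, if d + u ∈ F' then f (d + u) else 0 := by
  rw [← Finset.sum_filter, ← Finset.sum_filter]
  refine Finset.sum_bij' (fun a _ => a - u) (fun d _ => d + u) ?_ ?_ ?_ ?_ ?_
  · intro a ha
    simp only [Finset.mem_filter] at ha ⊢
    have e := tsub_add_cancel_of_le ha.2
    exact ⟨H _ (by rw [e]; exact ha.1), by rw [e]; exact ha.1⟩
  · intro d hd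
    simp only [Finset.mem_filter] at hd ⊢
    exact ⟨hd.2, le_add_self⟩
  · intro a ha
    simp only [Finset.mem_filter] at ha
    exact tsub_add_cancel_of_le ha.2
  · intro d hd
    exact add_tsub_cancel_right d u
  · intro a ha
    simp only [Finset.mem_filter] at ha
    rw [tsub_add_cancel_of_le ha.2]

theorem shift_lemma {g J : ℕ} (kc ℓc : (Fin g → ℕ) → ℝ) (hk : ∀ a, 0 ≤ kc a)
    (c : (Fin g → ℕ) → Matrix (Fin J) (Fin J) ℂ) (F F' : Finset (Fin g → ℕ))
    (h : Good kc ℓc c F) (u : Fin g → ℕ) (H : ∀ d, d + u ∈ F' → d ∈ F)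
    (x : (Fin g → ℕ) → Fin J → ℂ) :
    (∑ a ∈ F', if u ≤ a then kc (a - u) * sqn (cx c F' x a) else 0) ≤
      ∑ b ∈ F', if u ≤ b then ℓc (b - u) * sqn (x b) else 0 := by
  let y : (Fin g → ℕ) → Fin J → ℂ := fun d => if d + u ∈ F' then x (d + u) else 0
  have hcx : ∀ e, cx c F' x (e + u) = cx c F y e := by
    intro e
    have h1 : cx c F' x (e + u) =
        ∑ b ∈ F', if u ≤ b then (if e + u ≤ b then c (b - (e + u)) *ᵥ x b else 0) else 0 := by
      refine Finset.sum_congr rfl fun b _ => ?_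
      by_cases hb : e + u ≤ b
      · rw [if_pos hb, if_pos (le_add_self.trans hb)]
      · simp [hb]
    rw [h1, shift_sum F F' u H]
    refine Finset.sum_congr rfl fun d _ => ?_
    by_cases hd : d + u ∈ F'
    · simp [y, hd, add_tsub_add_eq_tsub_right]
    · simp [y, hd]
  rw [shift_sum F F' u H (fun a => kc (a - u) * sqn (cx c F' x a)),
    shift_sum F F' u H (fun b => ℓc (b - u) * sqn (x b))]
  calc _ ≤ ∑ d ∈ F, kc d * sqn (cx c F y d) := by
        refine Finset.sum_le_sum fun d _ => ?_
        split_ifs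
        · rw [hcx, add_tsub_cancel_right]
        · exact mul_nonneg (hk _) (sqn_nonneg _)
    _ ≤ ∑ d ∈ F, ℓc d * sqn (y d) := h y
    _ ≤ _ := by
        refine Finset.sum_le_sum fun d _ => ?_
        by_cases hd : d + u ∈ F'
        · simp [y, hd]
        · simp [y, hd, sqn_zero]

theorem good_pos {g J : ℕ} (kc ℓc T : (Fin g → ℕ) → ℝ) (hk : ∀ a, 0 < kc a)
    (hT : ∀ a, 0 ≤ T a) (hT0 : T 0 = 0)
    (hK : ∀ a, a ≠ 0 → kc a ≤ ∑ u ∈ Finset.Icc 0 a, T u * kc (a - u))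
    (hL : ∀ a, ∑ u ∈ Finset.Icc 0 a, T u * ℓc (a - u) ≤ ℓc a)
    (c : (Fin g → ℕ) → Matrix (Fin J) (Fin J) ℂ) (F : Finset (Fin g → ℕ)) (b : Fin g → ℕ)
    (hF : IsCoinvariant F) (hb : b ∉ F) (hF' : IsCoinvariant (insert b F))
    (h : Good kc ℓc c F) :
    Good (fun a => if a = 0 then 0 else kc a) ℓc c (insert b F) := by
  intro x
  set F' := insert b F with hF'def
  have hIcc : ∀ a ∈ F', ∀ f : (Fin g → ℕ) → ℝ,
      ∑ u ∈ Finset.Icc 0 a, f u = ∑ u ∈ F', if u ≤ a then f u else 0 := by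
    intro a ha f
    rw [← Finset.sum_filter]
    refine Finset.sum_congr ?_ fun _ _ => rfl
    ext u
    simp only [Finset.mem_Icc, Finset.mem_filter, zero_le, true_and]
    exact ⟨fun hu => ⟨hF' a ha u hu, hu⟩, fun hu => hu.2⟩
  have hH : ∀ u, u ≠ 0 → ∀ d, d + u ∈ F' → d ∈ F := by
    intro u hu d hd
    have h1 : d ∈ F' := hF' _ hd d le_self_add
    rcases Finset.mem_insert.1 h1 with rfl | h1
    · rcases Finset.mem_insert.1 hd with h2 | h2
      · exact absurd (by simpa using h2) hu
      · exact hF _ h2 _ le_self_add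
    · exact h1
  calc _ ≤ ∑ a ∈ F', (∑ u ∈ F', if u ≤ a then T u * kc (a - u) else 0) * sqn (cx c F' x a) := by
        refine Finset.sum_le_sum fun a ha => ?_
        refine mul_le_mul_of_nonneg_right ?_ (sqn_nonneg _)
        rw [← hIcc a ha]
        beta_reduce; split_ifs with h0
        · exact Finset.sum_nonneg fun u _ => mul_nonneg (hT u) (hk _).le
        · exact hK a h0
    _ = ∑ u ∈ F', T u * ∑ a ∈ F', if u ≤ a then kc (a - u) * sqn (cx c F' x a) else 0 := by
        simp only [Finset.sum_mul, Finset.mul_sum]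
        rw [Finset.sum_comm]
        refine Finset.sum_congr rfl fun u _ => Finset.sum_congr rfl fun a _ => ?_
        split_ifs <;> ring
    _ ≤ ∑ u ∈ F', T u * ∑ a ∈ F', if u ≤ a then ℓc (a - u) * sqn (x a) else 0 := by
        refine Finset.sum_le_sum fun u _ => ?_
        by_cases hu : u = 0
        · simp [hu, hT0]
        · exact mul_le_mul_of_nonneg_left
            (shift_lemma kc ℓc (fun a => (hk a).le) c F F' h u (hH u hu) x) (hT u)
    _ = ∑ a ∈ F', (∑ u ∈ F', if u ≤ a then T u * ℓc (a - u) else 0) * sqn (x a) := by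
        simp only [Finset.sum_mul, Finset.mul_sum]
        rw [Finset.sum_comm]
        refine Finset.sum_congr rfl fun u _ => Finset.sum_congr rfl fun a _ => ?_
        split_ifs <;> ring
    _ ≤ _ := by
        refine Finset.sum_le_sum fun a ha => ?_
        refine mul_le_mul_of_nonneg_right ?_ (sqn_nonneg _)
        rw [← hIcc a ha]
        exact hL a

theorem norm_toLp_sqn {J : ℕ} (v : Fin J → ℂ) : ‖WithLp.toLp 2 v‖ ^ 2 = sqn v := by
  rw [EuclideanSpace.norm_sq_eq]; rfl

theorem one_step {g J : ℕ} (kc ℓc T : (Fin g → ℕ) → ℝ) (hk : ∀ a, 0 < kc a) (hk0 : kc 0 = 1)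
    (hℓ : ∀ a, 0 < ℓc a)
    (hT : ∀ a, 0 ≤ T a) (hT0 : T 0 = 0)
    (hK : ∀ a, a ≠ 0 → kc a ≤ ∑ u ∈ Finset.Icc 0 a, T u * kc (a - u))
    (hL : ∀ a, ∑ u ∈ Finset.Icc 0 a, T u * ℓc (a - u) ≤ ℓc a)
    (c : (Fin g → ℕ) → Matrix (Fin J) (Fin J) ℂ) (F : Finset (Fin g → ℕ)) (b : Fin g → ℕ)
    (hF : IsCoinvariant F) (hb : b ∉ F) (hF' : IsCoinvariant (insert b F))
    (h : Good kc ℓc c F) :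
    ∃ X, Good kc ℓc (Function.update c b X) (insert b F) := by
  have h0F' : (0 : Fin g → ℕ) ∈ insert b F :=
    hF' b (Finset.mem_insert_self _ _) 0 (zero_le)
  have hpos := good_pos kc ℓc T hk hT hT0 hK hL c F b hF hb hF' h
  obtain ⟨M, hM⟩ := good_factor _ ℓc
    (fun a => by split_ifs; exacts [le_rfl, (hk a).le]) hℓ c _ hpos
  -- splitting of a sum over rows
  have hsplit : ∀ f : (Fin g → ℕ) → ℝ, ∑ a ∈ insert b F, kc a * f a =
      f 0 + ∑ a ∈ insert b F, (if a = 0 then 0 else kc a) * f a := by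
    intro f
    rw [← Finset.add_sum_erase _ _ h0F', ← Finset.add_sum_erase (insert b F)
      (fun a => (if a = 0 then 0 else kc a) * f a) h0F', hk0]
    simp only [if_true, zero_mul, zero_add, one_mul]
    congr 1
    refine Finset.sum_congr rfl fun a ha => ?_
    rw [if_neg (Finset.ne_of_mem_erase ha)]
  let R : ((Fin g → ℕ) → Fin J → ℂ) →ₗ[ℂ] EuclideanSpace ℂ (Fin J) :=
    { toFun := fun x => WithLp.toLp 2 (cx c F x 0)
      map_add' := by
        intro x y
        rw [← WithLp.toLp_add]; congr 1
        simp only [cx, zero_le, if_true, Pi.add_apply, Matrix.mulVec_add, Finset.sum_add_distrib]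
      map_smul' := by
        intro r x
        rw [RingHom.id_apply, ← WithLp.toLp_smul]; congr 1
        simp only [cx, zero_le, if_true, Pi.smul_apply, Matrix.mulVec_smul, Finset.smul_sum] }
  let W : Submodule ℂ ((Fin g → ℕ) → Fin J → ℂ) :=
    LinearMap.ker (LinearMap.proj b : ((Fin g → ℕ) → Fin J → ℂ) →ₗ[ℂ] (Fin J → ℂ))
  have hR : ∀ w ∈ W, ‖R w‖ ≤ ‖M w‖ := by
    intro w hw
    have hwb : w b = 0 := hw
    rw [← sq_le_sq₀ (norm_nonneg _) (norm_nonneg _), hM]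
    have e1 : ‖R w‖ ^ 2 = sqn (cx c F w 0) := norm_toLp_sqn _
    have e2 : ∀ a, cx c (insert b F) w a = cx c F w a := by
      intro a
      rw [cx, Finset.sum_insert hb, hwb]
      simp [cx]
    have e3 := hsplit (fun a => sqn (cx c F w a))
    have e4 : cx c F w b = 0 := by
      refine Finset.sum_eq_zero fun d hd => ?_
      rw [if_neg]
      exact fun hle => hb (hF d hd b hle)
    have e5 : ∑ a ∈ insert b F, kc a * sqn (cx c F w a) = ∑ a ∈ F, kc a * sqn (cx c F w a) := by
      rw [Finset.sum_insert hb, e4, sqn_zero]; ring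
    have e6 : ∑ a ∈ insert b F, ℓc a * sqn (w a) = ∑ a ∈ F, ℓc a * sqn (w a) := by
      rw [Finset.sum_insert hb, hwb, sqn_zero]; ring
    have e7 := h w
    simp only [e2]
    rw [e1, e6]
    linarith
  obtain ⟨R', hR'1, hR'2⟩ := contr_ext W M R hR
  let X : Matrix (Fin J) (Fin J) ℂ := LinearMap.toMatrix'
    ((WithLp.linearEquiv 2 ℂ (Fin J → ℂ)).toLinearMap ∘ₗ R' ∘ₗ
      LinearMap.single ℂ (fun _ : Fin g → ℕ => Fin J → ℂ) b)
  have hX : ∀ v, X *ᵥ v = WithLp.ofLp (R' (Pi.single b v)) := by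
    intro v
    rw [← Matrix.toLin'_apply, Matrix.toLin'_toMatrix']
    rfl
  refine ⟨X, fun x => ?_⟩
  have hrow : ∀ a, a ≠ 0 → cx (Function.update c b X) (insert b F) x a = cx c (insert b F) x a := by
    intro a ha
    refine Finset.sum_congr rfl fun d hd => ?_
    split_ifs with hle
    · rw [Function.update_of_ne]
      intro hda
      have hbd : b + a = d := by rw [← hda]; exact tsub_add_cancel_of_le hle
      rcases Finset.mem_insert.1 hd with h2 | h2
      · exact ha (by rw [h2] at hbd; simpa using hbd)
      · exact hb (hF d h2 b (hbd ▸ le_self_add))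
    · rfl
  have hrow0 : cx (Function.update c b X) (insert b F) x 0 = WithLp.ofLp (R' x) := by
    have e1 : R' x = R' (x - Pi.single b (x b)) + R' (Pi.single b (x b)) := by
      rw [← map_add, sub_add_cancel]
    have e2 : R' (x - Pi.single b (x b)) = R (x - Pi.single b (x b)) :=
      hR'1 _ (by simp [W])
    have e3 : cx c F (x - Pi.single b (x b)) 0 = cx c F x 0 := by
      refine Finset.sum_congr rfl fun d hd => ?_
      have : d ≠ b := fun e => hb (e ▸ hd)
      simp [this]
    have e4 : WithLp.ofLp (R (x - Pi.single b (x b))) = cx c F x 0 := e3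
    rw [e1, e2, WithLp.ofLp_add, e4, ← hX, cx, Finset.sum_insert hb, add_comm]
    congr 1
    · refine Finset.sum_congr rfl fun d hd => ?_
      have : d ≠ b := fun e => hb (e ▸ hd)
      simp [this]
    · simp
  rw [hsplit, hrow0]
  have f1 : ∑ a ∈ insert b F, (if a = 0 then 0 else kc a) *
        sqn (cx (Function.update c b X) (insert b F) x a) =
      ∑ a ∈ insert b F, (if a = 0 then 0 else kc a) * sqn (cx c (insert b F) x a) := by
    refine Finset.sum_congr rfl fun a _ => ?_
    by_cases ha : a = 0
    · simp [ha]
    · rw [hrow a ha]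
  rw [f1]
  have f2 := hM x
  have f3 : ‖R' x‖ ^ 2 ≤ ‖M x‖ ^ 2 := pow_le_pow_left₀ (norm_nonneg _) (hR'2 x) 2
  have f4 : ‖R' x‖ ^ 2 = sqn (WithLp.ofLp (R' x)) := norm_toLp_sqn _
  linarith

theorem good_congr {g J : ℕ} {kc ℓc : (Fin g → ℕ) → ℝ}
    {c c' : (Fin g → ℕ) → Matrix (Fin J) (Fin J) ℂ} {F : Finset (Fin g → ℕ)}
    (hF : IsCoinvariant F) (hc : ∀ a ∈ F, c' a = c a) (h : Good kc ℓc c F) :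
    Good kc ℓc c' F := by
  intro x
  have : ∀ a, cx c' F x a = cx c F x a := fun a =>
    Finset.sum_congr rfl fun d hd => by rw [hc _ (hF d hd _ tsub_le_self)]
  simp only [this]
  exact h x

theorem good_mono {g J : ℕ} {kc ℓc : (Fin g → ℕ) → ℝ} (hk : ∀ a, 0 < kc a)
    {c : (Fin g → ℕ) → Matrix (Fin J) (Fin J) ℂ} {S F : Finset (Fin g → ℕ)}
    (hS : S ⊆ F) (h : Good kc ℓc c F) : Good kc ℓc c S := by
  intro x
  let y : (Fin g → ℕ) → Fin J → ℂ := fun d => if d ∈ S then x d else 0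
  have e1 : ∀ a, cx c S x a = cx c F y a := by
    intro a
    rw [cx, cx, ← Finset.sum_subset hS]
    · refine Finset.sum_congr rfl fun d hd => by simp [y, hd]
    · intro d _ hd; simp [y, hd]
  have e2 : ∑ d ∈ S, ℓc d * sqn (x d) = ∑ d ∈ F, ℓc d * sqn (y d) := by
    rw [← Finset.sum_subset hS]
    · refine Finset.sum_congr rfl fun d hd => by simp [y, hd]
    · intro d _ hd; simp [y, hd, sqn_zero]
  rw [e2]
  refine le_trans ?_ (h y)
  simp only [e1]
  exact Finset.sum_le_sum_of_subset_of_nonneg hS fun a _ _ =>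
    mul_nonneg (hk a).le (sqn_nonneg _)

theorem many_steps {g J : ℕ} (kc ℓc : (Fin g → ℕ) → ℝ)
    (step : ∀ (c : (Fin g → ℕ) → Matrix (Fin J) (Fin J) ℂ) (F : Finset (Fin g → ℕ))
      (b : Fin g → ℕ), IsCoinvariant F → b ∉ F → IsCoinvariant (insert b F) →
      Good kc ℓc c F → ∃ X, Good kc ℓc (Function.update c b X) (insert b F))
    (F' : Finset (Fin g → ℕ)) (hF' : IsCoinvariant F') (n : ℕ) :
    ∀ (F : Finset (Fin g → ℕ)) (c : (Fin g → ℕ) → Matrix (Fin J) (Fin J) ℂ),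
      IsCoinvariant F → F ⊆ F' → (F' \ F).card = n → Good kc ℓc c F →
      ∃ c', (∀ a ∈ F, c' a = c a) ∧ Good kc ℓc c' F' := by
  induction n with
  | zero =>
    intro F c hF hs hn h
    have : F = F' := hs.antisymm (Finset.sdiff_eq_empty_iff_subset.1 (Finset.card_eq_zero.1 hn))
    exact ⟨c, fun _ _ => rfl, this ▸ h⟩
  | succ n ih =>
    intro F c hF hs hn h
    have hne : (F' \ F).Nonempty := Finset.card_pos.1 (by omega)
    obtain ⟨b, hbm⟩ := Finset.exists_minimal hne
    have hb := Finset.mem_sdiff.1 hbm.1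
    have hco : IsCoinvariant (insert b F) := by
      intro d hd a had
      rcases Finset.mem_insert.1 hd with rfl | hd
      · by_cases haF : a ∈ F
        · exact Finset.mem_insert_of_mem haF
        · have : d ≤ a := hbm.2 (Finset.mem_sdiff.2 ⟨hF' _ hb.1 _ had, haF⟩) had
          rw [le_antisymm had this]; exact Finset.mem_insert_self _ _
      · exact Finset.mem_insert_of_mem (hF d hd a had)
    obtain ⟨X, hX⟩ := step c F b hF hb.2 hco h
    obtain ⟨c', h1, h2⟩ := ih (insert b F) _ hco (Finset.insert_subset hb.1 hs) (by
      rw [Finset.sdiff_insert, Finset.card_erase_of_mem hbm.1, hn]; rfl) hX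
    refine ⟨c', fun a ha => ?_, h2⟩
    rw [h1 a (Finset.mem_insert_of_mem ha), Function.update_of_ne]
    rintro rfl; exact hb.2 ha

/-- If `(k, ℓ)` admits a formal Shimorin certificate — nonnegative `t_a` (`a ≠ 0`), `g_a`,
`h_a` with `g_0 = 1`, `h_0 = 0`, `ℓ_a = g_a + Σ_{0<u≤a} t_u ℓ_{a−u}` and
`k_a + h_a = Σ_{0<u≤a} t_u k_{a−u}` for all `a ≠ 0` — then `(k, ℓ)` is a complete
Carathéodory pair. -/
theorem formal_certificate_implies_CC {g : ℕ} (hg : 1 ≤ g)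
    (Ω : Set (Fin g → ℂ)) (hΩo : IsOpen Ω) (hΩc : IsConnected Ω)
    (h0 : (0 : Fin g → ℂ) ∈ Ω)
    (kc ℓc : (Fin g → ℕ) → ℝ)
    (hk : IsNormalizedDiag Ω kc) (hℓ : IsNormalizedDiag Ω ℓc)
    (t gc hc : (Fin g → ℕ) → ℝ)
    (ht : ∀ a : Fin g → ℕ, a ≠ 0 → 0 ≤ t a)
    (hgc : ∀ a, 0 ≤ gc a) (hhc : ∀ a, 0 ≤ hc a)
    (hg0 : gc 0 = 1) (hh0 : hc 0 = 0)
    (hfactℓ : ∀ a : Fin g → ℕ, a ≠ 0 →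
      ℓc a = gc a + ∑ u ∈ Finset.Icc (0 : Fin g → ℕ) a,
        (if u ≠ 0 then t u * ℓc (a - u) else 0))
    (hfactk : ∀ a : Fin g → ℕ, a ≠ 0 →
      kc a + hc a = ∑ u ∈ Finset.Icc (0 : Fin g → ℕ) a,
        (if u ≠ 0 then t u * kc (a - u) else 0)) :
    IsCCPair kc ℓc := by
  have hkp := hk.2.1
  have hℓp := hℓ.2.1
  let T : (Fin g → ℕ) → ℝ := fun u => if u ≠ 0 then t u else 0
  have hTe : ∀ (f : (Fin g → ℕ) → ℝ) (u : Fin g → ℕ),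
      (if u ≠ 0 then t u * f u else 0) = T u * f u := by
    intro f u; simp only [T]; split_ifs <;> simp
  have hT : ∀ a, 0 ≤ T a := by
    intro a; simp only [T]; split_ifs with h
    exacts [ht a h, le_rfl]
  have hT0 : T 0 = 0 := by simp [T]
  have hK : ∀ a, a ≠ 0 → kc a ≤ ∑ u ∈ Finset.Icc 0 a, T u * kc (a - u) := by
    intro a ha
    have h1 := hfactk a ha
    have h2 : ∑ u ∈ Finset.Icc 0 a, T u * kc (a - u) = ∑ u ∈ Finset.Icc (0 : Fin g → ℕ) a,
        (if u ≠ 0 then t u * kc (a - u) else 0) :=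
      Finset.sum_congr rfl fun u _ => (hTe (fun u => kc (a - u)) u).symm
    rw [h2]
    linarith [hhc a]
  have hL : ∀ a, ∑ u ∈ Finset.Icc 0 a, T u * ℓc (a - u) ≤ ℓc a := by
    intro a
    by_cases ha : a = 0
    · subst ha
      simp [hT0, (hℓp 0).le]
    have h1 := hfactℓ a ha
    have h2 : ∑ u ∈ Finset.Icc 0 a, T u * ℓc (a - u) = ∑ u ∈ Finset.Icc (0 : Fin g → ℕ) a,
        (if u ≠ 0 then t u * ℓc (a - u) else 0) :=
      Finset.sum_congr rfl fun u _ => (hTe (fun u => ℓc (a - u)) u).symm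
    rw [h2]
    linarith [hgc a]
  intro J _ F hF c₀ hc₀
  rw [good_iff kc ℓc (fun a => (hkp a).le) hℓp] at hc₀
  have ext := fun F' hF' F c h1 h2 h3 => many_steps (J := J) kc ℓc
    (one_step kc ℓc T hkp hk.1 hℓp hT hT0 hK hL) F' hF' _ F c h1 h2 rfl h3
  let Fn : ℕ → Finset (Fin g → ℕ) := fun n => F ∪ Finset.Icc 0 (fun _ => n)
  have hFn : ∀ n, IsCoinvariant (Fn n) := by
    intro n b hb a hab
    rcases Finset.mem_union.1 hb with hb | hb
    · exact Finset.mem_union_left _ (hF b hb a hab)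
    · exact Finset.mem_union_right _
        (Finset.mem_Icc.2 ⟨zero_le, hab.trans (Finset.mem_Icc.1 hb).2⟩)
  have hmono : Monotone Fn := by
    intro m n hmn
    refine Finset.union_subset_union_right (Finset.Icc_subset_Icc_right ?_)
    intro i; exact hmn
  let N : (Fin g → ℕ) → ℕ := fun a => ∑ i, a i
  have hN : ∀ a n, N a ≤ n → a ∈ Fn n := by
    intro a n h
    refine Finset.mem_union_right _ (Finset.mem_Icc.2 ⟨zero_le, fun i => ?_⟩)
    exact (Finset.single_le_sum (f := a) (fun _ _ => Nat.zero_le _) (Finset.mem_univ i)).trans h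
  obtain ⟨d₀, hd1, hd2⟩ := ext (Fn 0) (hFn 0) F c₀ hF Finset.subset_union_left hc₀
  choose nx hnx1 hnx2 using fun (n : ℕ)
    (c : {c : (Fin g → ℕ) → Matrix (Fin J) (Fin J) ℂ // Good kc ℓc c (Fn n)}) =>
    ext (Fn (n + 1)) (hFn _) (Fn n) c.1 (hFn n) (hmono (Nat.le_succ n)) c.2
  let C : (n : ℕ) → {c : (Fin g → ℕ) → Matrix (Fin J) (Fin J) ℂ // Good kc ℓc c (Fn n)} :=
    fun n => Nat.rec ⟨d₀, hd2⟩ (fun n c => ⟨nx n c, hnx2 n c⟩) n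
  have hC : ∀ n, ∀ a ∈ Fn n, (C (n + 1)).1 a = (C n).1 a := fun n a ha => hnx1 n (C n) a ha
  have hC' : ∀ m n, m ≤ n → ∀ a ∈ Fn m, (C n).1 a = (C m).1 a := by
    intro m n hmn a ha
    induction n, hmn using Nat.le_induction with
    | base => rfl
    | succ n hmn ih => rw [hC n a (hmono hmn ha), ih]
  have hc : ∀ n, ∀ a ∈ Fn n, (C (N a)).1 a = (C n).1 a := by
    intro n a ha
    rw [← hC' n (max n (N a)) (le_max_left _ _) a ha,
      ← hC' (N a) (max n (N a)) (le_max_right _ _) a (hN a _ le_rfl)]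
  refine ⟨fun a => (C (N a)).1 a, ?_, ?_⟩
  · intro a ha
    show (C (N a)).1 a = c₀ a
    rw [hc 0 a (Finset.mem_union_left _ ha)]
    exact hd1 a ha
  · intro S
    rw [good_iff kc ℓc (fun a => (hkp a).le) hℓp]
    have hS : S ⊆ Fn (S.sup N) := fun a ha => hN a _ (Finset.le_sup ha)
    exact good_mono hkp hS (good_congr (hFn _) (hc _) (C _).2)
end
end

section
/- Let k and ℓ be normalized diagonal holomorphic kernels with coefficients (k_a) and (ℓ_a), a ∈ ℕ^𝗀, and let (θ_a) be the master certificate associated with k. If (k, ℓ) is a complete Carathéodory pair, then for every a ∈ ℕ^𝗀 with a ≠ 0: ℓ_a − Σ_{0 < u ≤ a} θ_u·ℓ_{a−u} ≥ 0. -/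
open Matrix
open scoped ComplexOrder

noncomputable section
open scoped Classical

/-- `θ` is the master certificate associated with the coefficient family `kc`: `θ_0 = 0`,
`θ_b = k_b` when `|b| = 1`, and `θ_b = max (0, k_b − Σ_{0 < w < b} θ_w k_{b−w})` when
`|b| ≥ 2`. -/
def IsMasterCert {g : ℕ} (kc θ : (Fin g → ℕ) → ℝ) : Prop :=
  θ 0 = 0 ∧
  (∀ b : Fin g → ℕ, (∑ i, b i) = 1 → θ b = kc b) ∧
  ∀ b : Fin g → ℕ, 2 ≤ ∑ i, b i →
    θ b = max 0 (kc b -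
      ∑ w ∈ Finset.Icc (0 : Fin g → ℕ) b,
        if w ≠ 0 ∧ w ≠ b then θ w * kc (b - w) else 0)

lemma aux_le_sub {g : ℕ} {a u v : Fin g → ℕ} : (u ≤ a ∧ v ≤ a - u) ↔ (v ≤ a ∧ u ≤ a - v) := by
  simp only [Pi.le_def, Pi.sub_apply]
  constructor
  · rintro ⟨h1, h2⟩
    exact ⟨fun i => by have := h1 i; have := h2 i; omega,
      fun i => by have := h1 i; have := h2 i; omega⟩
  · rintro ⟨h1, h2⟩
    exact ⟨fun i => by have := h1 i; have := h2 i; omega,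
      fun i => by have := h1 i; have := h2 i; omega⟩

lemma aux_sub_ne {g : ℕ} {a u : Fin g → ℕ} (h : u < a) : a - u ≠ 0 := by
  intro h0
  apply h.not_ge
  intro i
  have h2 : a i - u i = 0 := congrFun h0 i
  change a i ≤ u i
  omega

lemma aux_sub_lt {g : ℕ} {a u : Fin g → ℕ} (h : u ≤ a) (h0 : u ≠ 0) : a - u < a := by
  refine lt_of_le_of_ne (fun i => by simp) ?_
  intro he
  apply h0
  funext i
  have h1 : a i - u i = a i := congrFun he i
  have h2 : u i ≤ a i := h i
  change u i = 0
  omega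

lemma aux_sub_sub {g : ℕ} {a u : Fin g → ℕ} (h : u ≤ a) : a - (a - u) = u := by
  funext i
  have h2 : u i ≤ a i := h i
  change a i - (a i - u i) = u i
  omega

lemma aux_reflect {g : ℕ} (a : Fin g → ℕ) (f : (Fin g → ℕ) → (Fin g → ℕ) → ℝ) :
    ∑ u ∈ Finset.Icc 0 a, f u (a - u) = ∑ p ∈ Finset.Icc 0 a, f (a - p) p := by
  refine Finset.sum_bij' (fun u _ => a - u) (fun u _ => a - u) ?_ ?_ ?_ ?_ ?_
  · intro u hu; simp [Finset.mem_Icc]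
  · intro u hu; simp [Finset.mem_Icc]
  · intro u hu; exact aux_sub_sub (Finset.mem_Icc.1 hu).2
  · intro u hu; exact aux_sub_sub (Finset.mem_Icc.1 hu).2
  · intro u hu; simp only [aux_sub_sub (Finset.mem_Icc.1 hu).2]

lemma aux_Icc_Ico {g : ℕ} (b : Fin g → ℕ) (f : (Fin g → ℕ) → ℝ) :
    ∑ u ∈ Finset.Icc 0 b, f u = ∑ u ∈ Finset.Ico 0 b, f u + f b := by
  rw [← Finset.Ico_insert_right (show (0 : Fin g → ℕ) ≤ b from fun i => Nat.zero_le _),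
    Finset.sum_insert (by simp)]
  ring

lemma lemA {g : ℕ} (kc ℓc : (Fin g → ℕ) → ℝ) (hk : ∀ a, 0 < kc a) (hℓ : ∀ a, 0 < ℓc a)
    (hCC : IsCCPair kc ℓc) (a : Fin g → ℕ) (t : (Fin g → ℕ) → ℝ)
    (ht : ∀ b, b < a → 0 ≤ t b)
    (hT : ∀ b, b < a → ∑ u ∈ Finset.Icc 0 b, t u * kc (b - u) ≤ ℓc b) :
    ∑ u ∈ Finset.Ico 0 a, t u * kc (a - u) ≤ ℓc a := by
  set F : Finset (Fin g → ℕ) := Finset.Ico 0 a with hF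
  have memF : ∀ b, b ∈ F ↔ b < a := fun b => by
    rw [hF, Finset.mem_Ico]
    exact ⟨fun h => h.2, fun h => ⟨fun i => Nat.zero_le _, h⟩⟩
  let e := F.equivFin
  let idx : (Fin g → ℕ) → Fin (F.card + 1) := fun u =>
    if h : u ∈ F then (e ⟨u, h⟩).castSucc else Fin.last _
  have idx_inj : ∀ u ∈ F, ∀ v ∈ F, idx u = idx v → u = v := by
    intro u hu v hv h
    simp only [idx, hu, hv, dif_pos] at h
    have := e.injective (Fin.castSucc_injective _ h)
    simpa using this
  let c₀ : (Fin g → ℕ) → Matrix (Fin (F.card + 1)) (Fin (F.card + 1)) ℂ := fun u l i =>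
    if l = idx u ∧ i = 0 then (Real.sqrt (t u) : ℂ) else 0
  have hco : IsCoinvariant F := by
    intro b hb x hx
    rw [memF] at *
    exact lt_of_le_of_lt hx hb
  have hcon : IsContractionMat (caraMatrix kc ℓc c₀ F) := by
    have : (1 - (caraMatrix kc ℓc c₀ F)ᴴ * caraMatrix kc ℓc c₀ F) =
        Matrix.diagonal (fun q : F × Fin (F.card + 1) => if q.2 = 0 then
          (((1 - (∑ u ∈ Finset.Icc 0 (q.1 : Fin g → ℕ), t u * kc (q.1 - u)) / ℓc q.1 : ℝ)) : ℂ)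
            else 1) := by
      ext q q'
      rw [Matrix.sub_apply, Matrix.mul_apply, Fintype.sum_prod_type]
      have key : ∀ p : F, ∑ l, (caraMatrix kc ℓc c₀ F)ᴴ q (p, l) * caraMatrix kc ℓc c₀ F (p, l) q'
          = if q = q' ∧ q.2 = 0 ∧ (p : Fin g → ℕ) ≤ q.1 then
            ((t (q.1 - p) * kc p / ℓc q.1 : ℝ) : ℂ) else 0 := by
        intro p
        obtain ⟨q, i⟩ := q
        obtain ⟨q', j⟩ := q'
        simp only [Matrix.conjTranspose_apply, caraMatrix, c₀]
        by_cases h1 : (p : Fin g → ℕ) ≤ q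
        swap
        · simp [h1]
        by_cases h2 : (p : Fin g → ℕ) ≤ q'
        swap
        · have : q ≠ q' := by rintro rfl; exact h2 h1
          simp [h2, this]
        by_cases hi : i = 0
        swap
        · simp [hi]
        by_cases hj : j = 0
        swap
        · have : i ≠ j := by rintro rfl; exact hj hi
          simp [hj, this]
        subst hi hj
        have mq : ∀ q : F, (q : Fin g → ℕ) - p ∈ F := fun q => by
          rw [memF]
          exact lt_of_le_of_lt (fun i => by simp) ((memF _).1 q.2)
        by_cases hq : q = q'
        · subst hq
          simp only [h1, if_true, and_true]
          rw [Finset.sum_eq_single (idx (q - p))]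
          · simp only [if_true, star_mul', RCLike.star_def, Complex.conj_ofReal]
            norm_cast
            have e1 := Real.mul_self_sqrt (ht _ ((memF _).1 (mq q)))
            have e2 := Real.mul_self_sqrt (div_pos (hk p) (hℓ q)).le
            calc _ = (√(kc p / ℓc q) * √(kc p / ℓc q)) * (√(t (q - p)) * √(t (q - p))) := by ring
              _ = _ := by rw [e1, e2]; ring
          · intro l _ hl
            simp [hl]
          · simp
        · have : (q : Fin g → ℕ) - p ≠ q' - p := by
            intro h
            apply hq
            ext i
            have := congrFun h i
            have := h1 i
            have := h2 i
            simp only [Pi.sub_apply] at *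
            omega
          rw [if_neg (by simp [hq])]
          apply Finset.sum_eq_zero
          intro l _
          by_cases hl : l = idx (q - p)
          · have : l ≠ idx (q' - p) := by
              rintro rfl
              exact this (idx_inj _ (mq q) _ (mq q') hl.symm)
            simp [this]
          · simp [hl]
      simp only [key]
      by_cases hq : q = q'
      · subst hq
        rw [Matrix.diagonal_apply_eq, Matrix.one_apply_eq]
        by_cases hi : q.2 = 0
        · simp only [hi, true_and, if_true]
          rw [Finset.sum_coe_sort F (fun p => if p ≤ (q.1 : Fin g → ℕ) then
            ((t (q.1 - p) * kc p / ℓc q.1 : ℝ) : ℂ) else 0), ← Finset.sum_filter]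
          have : F.filter (fun p => p ≤ (q.1 : Fin g → ℕ)) = Finset.Icc 0 (q.1 : Fin g → ℕ) := by
            ext p
            rw [Finset.mem_filter, memF, Finset.mem_Icc]
            exact ⟨fun h => ⟨fun i => Nat.zero_le _, h.2⟩,
              fun h => ⟨lt_of_le_of_lt h.2 ((memF _).1 q.1.2), h.2⟩⟩
          rw [this, aux_reflect _ (fun u v => t u * kc v), Finset.sum_div]
          push_cast
          rfl
        · simp [hi]
      · simp [hq]
    unfold IsContractionMat
    rw [this]
    refine Matrix.PosSemidef.diagonal ?_
    intro q
    dsimp only [Pi.zero_apply]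
    split_ifs
    · rw [Complex.zero_le_real, sub_nonneg, div_le_one (hℓ _)]
      exact hT _ ((memF _).1 q.1.2)
    · exact zero_le_one
  obtain ⟨c, hc, hS⟩ := hCC _ (by omega) F hco c₀ hcon
  have h := hS (Finset.Icc 0 a)
  have haa : a ∈ Finset.Icc 0 a := by
    rw [Finset.mem_Icc]; exact ⟨fun i => Nat.zero_le _, le_rfl⟩
  have hd := h.diag_nonneg (i := (⟨a, haa⟩, 0))
  rw [Matrix.sub_apply, Matrix.one_apply_eq, Matrix.mul_apply, Fintype.sum_prod_type] at hd
  have hd' : 0 ≤ 1 - ∑ p : Finset.Icc 0 a, ∑ l, (kc p / ℓc a) * ‖c (a - p) l 0‖ ^ 2 := by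
    rw [← Complex.zero_le_real]
    refine hd.trans_eq ?_
    push_cast
    congr 1
    refine Finset.sum_congr rfl fun p _ => Finset.sum_congr rfl fun l _ => ?_
    have hp : (p : Fin g → ℕ) ≤ a := (Finset.mem_Icc.1 p.2).2
    simp only [Matrix.conjTranspose_apply, caraMatrix, hp, if_true, star_mul', RCLike.star_def,
      Complex.conj_ofReal]
    have e2 := Real.mul_self_sqrt (div_pos (hk p) (hℓ a)).le
    calc _ = ((√(kc p / ℓc a) * √(kc p / ℓc a) : ℝ) : ℂ) *
          ((starRingEnd ℂ) (c (a - p) l 0) * c (a - p) l 0) := by push_cast; ring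
      _ = _ := by rw [e2, Complex.conj_mul']; push_cast; ring
  rw [Finset.sum_coe_sort (Finset.Icc 0 a)
    (fun p => ∑ l, (kc p / ℓc a) * ‖c (a - p) l 0‖ ^ 2),
    ← aux_reflect a (fun u v => ∑ l, (kc v / ℓc a) * ‖c u l 0‖ ^ 2), aux_Icc_Ico] at hd'
  have hlast : 0 ≤ ∑ l, (kc (a - a) / ℓc a) * ‖c a l 0‖ ^ 2 :=
    Finset.sum_nonneg fun l _ => mul_nonneg (div_pos (hk _) (hℓ _)).le (by positivity)
  have hmain : ∑ u ∈ Finset.Ico 0 a, ∑ l, (kc (a - u) / ℓc a) * ‖c u l 0‖ ^ 2 =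
      (∑ u ∈ F, t u * kc (a - u)) / ℓc a := by
    rw [Finset.sum_div]
    refine Finset.sum_congr rfl fun u hu => ?_
    rw [hc u hu, Finset.sum_eq_single (idx u)]
    · simp only [c₀, and_self, if_true, Complex.norm_real, Real.norm_eq_abs, sq_abs]
      rw [Real.sq_sqrt (ht u ((memF u).1 hu))]
      ring
    · intro l _ hl
      simp [c₀, hl]
    · simp
  rw [hmain] at hd'
  rw [← div_le_one (hℓ a)]
  linarith

lemma exists_t {g : ℕ} (kc ℓc : (Fin g → ℕ) → ℝ) (R : (Fin g → ℕ) → Prop) :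
    ∃ t : (Fin g → ℕ) → ℝ, ∀ b, t b = if R b then
      ℓc b - ∑ u ∈ Finset.Ico 0 b, t u * kc (b - u) else 0 := by
  let G : (b : Fin g → ℕ) → ((v : Fin g → ℕ) → v < b → ℝ) → ℝ := fun b rec => if R b then
      ℓc b - ∑ u ∈ (Finset.Ico 0 b).attach, rec u (Finset.mem_Ico.1 u.2).2 * kc (b - u) else 0
  have wf : WellFounded (fun a b : Fin g → ℕ => a < b) := wellFounded_lt
  refine ⟨wf.fix G, fun b => ?_⟩
  rw [wf.fix_eq]
  simp only [G]
  rw [Finset.sum_attach (Finset.Ico 0 b) (fun u => wf.fix G u * kc (b - u))]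

/-- If `(k, ℓ)` is a complete Carathéodory pair of normalized diagonal holomorphic
kernels and `θ` is the master certificate of `k`, then
`ℓ_a − Σ_{0<u≤a} θ_u ℓ_{a−u} ≥ 0` for every `a ≠ 0`. -/
theorem CC_implies_master_inequality {g : ℕ} (hg : 1 ≤ g)
    (Ω : Set (Fin g → ℂ)) (hΩo : IsOpen Ω) (hΩc : IsConnected Ω)
    (h0 : (0 : Fin g → ℂ) ∈ Ω)
    (kc ℓc : (Fin g → ℕ) → ℝ)
    (hk : IsNormalizedDiag Ω kc) (hℓ : IsNormalizedDiag Ω ℓc)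
    (θ : (Fin g → ℕ) → ℝ) (hθ : IsMasterCert kc θ)
    (hCC : IsCCPair kc ℓc) :
    ∀ a : Fin g → ℕ, a ≠ 0 →
      0 ≤ ℓc a - ∑ u ∈ Finset.Icc (0 : Fin g → ℕ) a,
        (if u ≠ 0 then θ u * ℓc (a - u) else 0) := by
  obtain ⟨hk0, hkpos, -⟩ := hk
  obtain ⟨hℓ0, hℓpos, -⟩ := hℓ
  obtain ⟨hθ0, hθ1, hθ2⟩ := hθ
  intro a ha
  -- facts on θ
  have split : ∀ w : Fin g → ℕ, w ≠ 0 →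
      ∑ v ∈ Finset.Icc 0 w, (if v ≠ 0 then θ v * kc (w - v) else 0) =
      (∑ v ∈ Finset.Icc 0 w, if v ≠ 0 ∧ v ≠ w then θ v * kc (w - v) else 0) + θ w := by
    intro w hw
    rw [aux_Icc_Ico, aux_Icc_Ico]
    simp only [hw, ne_eq, not_false_eq_true, if_true, not_true_eq_false, and_false, if_false,
      tsub_self, hk0, mul_one, add_zero]
    congr 1
    refine Finset.sum_congr rfl fun v hv => ?_
    have : v ≠ w := (Finset.mem_Ico.1 hv).2.ne
    simp [this]
  have deg : ∀ w : Fin g → ℕ, w ≠ 0 → (∑ i, w i) = 1 ∨ 2 ≤ ∑ i, w i := by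
    intro w hw
    have : (∑ i, w i) ≠ 0 := by
      intro h
      apply hw
      funext i
      exact (Finset.sum_eq_zero_iff.1 h) i (Finset.mem_univ i)
    omega
  have hθnn : ∀ w, 0 ≤ θ w := by
    intro w
    by_cases hw : w = 0
    · rw [hw, hθ0]
    rcases deg w hw with h | h
    · rw [hθ1 w h]; exact (hkpos w).le
    · rw [hθ2 w h]; exact le_max_left _ _
  have hR : ∀ w, w ≠ 0 → θ w ≠ 0 →
      kc w = ∑ v ∈ Finset.Icc 0 w, (if v ≠ 0 then θ v * kc (w - v) else 0) := by
    intro w hw hne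
    rw [split w hw]
    rcases deg w hw with h | h
    · rw [hθ1 w h, Finset.sum_eq_zero, zero_add]
      intro v hv
      rw [if_neg]
      rintro ⟨h1, h2⟩
      have hlt : v < w := lt_of_le_of_ne (Finset.mem_Icc.1 hv).2 h2
      have : ∑ i, v i < ∑ i, w i := by
        obtain ⟨hle, i, hi⟩ := Pi.lt_def.1 hlt
        exact Finset.sum_lt_sum (fun i _ => hle i) ⟨i, Finset.mem_univ i, hi⟩
      rcases deg v h1 with h' | h' <;> omega
    · have := hθ2 w h
      rcases max_choice 0 (kc w - ∑ w_1 ∈ Finset.Icc (0 : Fin g → ℕ) w,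
        if w_1 ≠ 0 ∧ w_1 ≠ w then θ w_1 * kc (w - w_1) else 0) with h' | h'
      · rw [h'] at this; exact absurd this hne
      · rw [h'] at this; linarith
  obtain ⟨t, ht⟩ := exists_t kc ℓc (fun b => kc (a - b) =
    ∑ v ∈ Finset.Icc 0 (a - b), (if v ≠ 0 then θ v * kc (a - b - v) else 0))
  have main : ∀ b, b < a → 0 ≤ t b ∧ ∑ u ∈ Finset.Icc 0 b, t u * kc (b - u) ≤ ℓc b := by
    intro b
    induction b using WellFoundedLT.induction with
    | ind b ih =>
      intro hb
      have hA := lemA kc ℓc hkpos hℓpos hCC b t (fun v hv => (ih v hv (hv.trans hb)).1)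
        (fun v hv => (ih v hv (hv.trans hb)).2)
      rw [aux_Icc_Ico, tsub_self, hk0, mul_one, ht b]
      split_ifs
      · constructor <;> linarith
      · constructor <;> linarith
  have hA := lemA kc ℓc hkpos hℓpos hCC a t (fun v hv => (main v hv).1)
    (fun v hv => (main v hv).2)
  rw [sub_nonneg]
  refine le_trans (le_of_eq ?_) hA
  have step1 : ∀ u ∈ Finset.Ico 0 a, t u * kc (a - u) =
      ∑ v ∈ (Finset.Icc 0 (a - u)).filter (· ≠ 0), t u * (θ v * kc (a - u - v)) := by
    intro u _
    by_cases hu : kc (a - u) =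
      ∑ v ∈ Finset.Icc 0 (a - u), (if v ≠ 0 then θ v * kc (a - u - v) else 0)
    · rw [← Finset.mul_sum, Finset.sum_filter, ← hu]
    · have : t u = 0 := by rw [ht u, if_neg hu]
      simp [this]
  have step2 : ∀ v ∈ (Finset.Icc 0 a).filter (· ≠ 0), θ v * ℓc (a - v) =
      ∑ u ∈ Finset.Icc 0 (a - v), t u * (θ v * kc (a - u - v)) := by
    intro v hv
    rw [Finset.mem_filter, Finset.mem_Icc] at hv
    obtain ⟨⟨-, hva⟩, hv0⟩ := hv
    by_cases hz : θ v = 0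
    · simp [hz]
    have htv := ht (a - v)
    rw [aux_sub_sub hva, if_pos (hR v hv0 hz)] at htv
    have : ℓc (a - v) = ∑ u ∈ Finset.Icc 0 (a - v), t u * kc (a - v - u) := by
      rw [aux_Icc_Ico, tsub_self, hk0, mul_one]
      linarith
    rw [this, Finset.mul_sum]
    refine Finset.sum_congr rfl fun u _ => ?_
    rw [tsub_right_comm]
    ring
  rw [← Finset.sum_filter, Finset.sum_congr rfl step1, Finset.sum_congr rfl step2]
  apply Finset.sum_comm'
  intro v u
  simp only [Finset.mem_filter, Finset.mem_Icc, Finset.mem_Ico]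
  have z : ∀ x : Fin g → ℕ, 0 ≤ x := fun x i => Nat.zero_le _
  simp only [z, true_and]
  constructor
  · rintro ⟨⟨h1, h2⟩, h3⟩
    obtain ⟨h4, h5⟩ := aux_le_sub.1 ⟨h1, h3⟩
    refine ⟨⟨h5, h2⟩, lt_of_le_of_ne h4 ?_⟩
    rintro rfl
    apply h2
    simpa using h5
  · rintro ⟨⟨h1, h2⟩, h3⟩
    obtain ⟨h4, h5⟩ := aux_le_sub.1 ⟨h3.le, h1⟩
    exact ⟨⟨h4, h2⟩, h5⟩
end
end

section
/- If (k, ℓ) is a complete Pick pair of normalized diagonal holomorphic kernels on a domain Ω ⊆ ℂ^𝗀 with 0 ∈ Ω, then for every b ∈ ℕ^𝗀 there exists a constant C > 0 such that the function (z,w) ↦ C·ℓ(z,w) − z^b·conj(w^b)·k(z,w) is a positive kernel on Ω (that is, every monomial, and hence every matrix-valued polynomial, is a bounded multiplier from H_k to H_ℓ). -/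
open Matrix
open scoped ComplexOrder

noncomputable section

open scoped Classical

section aux

def Sg {g n : ℕ} (z : Fin n → Fin g → ℂ) (c : Fin n → ℂ) (a : Fin g → ℕ) : ℂ :=
  ∑ j, c j * (starRingEnd ℂ) (mpow (z j) a)

def GG {g n : ℕ} (kc : (Fin g → ℕ) → ℝ) (z : Fin n → Fin g → ℂ) (c : Fin n → ℂ) : ℝ :=
  ∑' a, kc a * ‖Sg z c a‖ ^ 2

lemma mpow_add' {g : ℕ} (z : Fin g → ℂ) (a b : Fin g → ℕ) :
    mpow z (a + b) = mpow z a * mpow z b := by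
  simp [mpow, pow_add, Finset.prod_mul_distrib]

lemma summable_diag {g : ℕ} {Ω : Set (Fin g → ℂ)} {kc : (Fin g → ℕ) → ℝ}
    (hk : IsNormalizedDiag Ω kc) {z w : Fin g → ℂ} (hz : z ∈ Ω) (hw : w ∈ Ω) :
    Summable fun a : Fin g → ℕ => (kc a : ℂ) * mpow z a * (starRingEnd ℂ) (mpow w a) := by
  refine Summable.of_norm_bounded ((hk.2.2 z hz).add (hk.2.2 w hw)) fun a => ?_
  have := (hk.2.1 a)
  simp only [norm_mul, RCLike.norm_conj, Complex.norm_real, Real.norm_eq_abs, abs_of_pos this]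
  have h : ‖mpow z a‖ * ‖mpow w a‖ ≤ ‖mpow z a‖ ^ 2 + ‖mpow w a‖ ^ 2 := by
    nlinarith [sq_nonneg (‖mpow z a‖ - ‖mpow w a‖), sq_nonneg (‖mpow z a‖),
      sq_nonneg (‖mpow w a‖)]
  calc _ = kc a * (‖mpow z a‖ * ‖mpow w a‖) := by ring
    _ ≤ kc a * (‖mpow z a‖ ^ 2 + ‖mpow w a‖ ^ 2) := by gcongr
    _ = _ := by ring

lemma gram_hasSum {g n : ℕ} {Ω : Set (Fin g → ℂ)} {kc : (Fin g → ℕ) → ℝ}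
    (hk : IsNormalizedDiag Ω kc) (z : Fin n → Fin g → ℂ) (hz : ∀ i, z i ∈ Ω) (c : Fin n → ℂ) :
    HasSum (fun a => ((kc a * ‖Sg z c a‖ ^ 2 : ℝ) : ℂ))
      (∑ i, ∑ j, (starRingEnd ℂ) (c i) * c j * diagKer kc (z i) (z j)) := by
  have h : HasSum (fun a => ∑ i, ∑ j, (starRingEnd ℂ) (c i) * c j *
      ((kc a : ℂ) * mpow (z i) a * (starRingEnd ℂ) (mpow (z j) a)))
      (∑ i, ∑ j, (starRingEnd ℂ) (c i) * c j * diagKer kc (z i) (z j)) := by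
    refine hasSum_sum fun i _ => hasSum_sum fun j _ => ?_
    exact (summable_diag hk (hz i) (hz j)).hasSum.mul_left _
  convert h using 2 with a
  push_cast
  rw [← Complex.conj_mul' (Sg z c a)]
  simp only [Sg, map_sum, map_mul, Complex.conj_conj]
  rw [Finset.sum_mul_sum, Finset.mul_sum]
  refine Finset.sum_congr rfl fun i _ => ?_
  rw [Finset.mul_sum]
  refine Finset.sum_congr rfl fun j _ => ?_
  ring

lemma gram_hasSum_real {g n : ℕ} {Ω : Set (Fin g → ℂ)} {kc : (Fin g → ℕ) → ℝ}
    (hk : IsNormalizedDiag Ω kc) (z : Fin n → Fin g → ℂ) (hz : ∀ i, z i ∈ Ω) (c : Fin n → ℂ) :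
    HasSum (fun a => kc a * ‖Sg z c a‖ ^ 2) (GG kc z c) :=
  (Complex.summable_ofReal.1 (gram_hasSum hk z hz c).summable).hasSum

lemma gram_eq {g n : ℕ} {Ω : Set (Fin g → ℂ)} {kc : (Fin g → ℕ) → ℝ}
    (hk : IsNormalizedDiag Ω kc) (z : Fin n → Fin g → ℂ) (hz : ∀ i, z i ∈ Ω) (c : Fin n → ℂ) :
    ∑ i, ∑ j, (starRingEnd ℂ) (c i) * c j * diagKer kc (z i) (z j) = (GG kc z c : ℂ) :=
  (gram_hasSum hk z hz c).unique (Complex.hasSum_ofReal.2 (gram_hasSum_real hk z hz c))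

lemma pick_iff {g n : ℕ} {Ω : Set (Fin g → ℂ)} {kc ℓc : (Fin g → ℕ) → ℝ}
    (hk : IsNormalizedDiag Ω kc) (hℓ : IsNormalizedDiag Ω ℓc) (z : Fin n → Ω)
    (W : Fin n → Matrix (Fin 1) (Fin 1) ℂ) :
    PickBlockPSD (fun z w : Ω => diagKer kc ↑z ↑w) (fun z w : Ω => diagKer ℓc ↑z ↑w) z W ↔
    ∀ u : Fin n → ℂ, GG kc (fun i => (z i : Fin g → ℂ)) (fun j => u j * (starRingEnd ℂ) (W j 0 0))
      ≤ GG ℓc (fun i => (z i : Fin g → ℂ)) u := by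
  have key : ∀ u : Fin n → (Fin 1 → ℂ), ∑ i, ∑ j,
      star (u i) ⬝ᵥ ((diagKer ℓc (z i) (z j) • (1 : Matrix (Fin 1) (Fin 1) ℂ)
        - diagKer kc (z i) (z j) • (W i * (W j)ᴴ)) *ᵥ u j) =
      ((GG ℓc (fun i => (z i : Fin g → ℂ)) (fun j => u j 0) -
        GG kc (fun i => (z i : Fin g → ℂ)) (fun j => u j 0 * (starRingEnd ℂ) (W j 0 0)) : ℝ) : ℂ) := by
    intro u
    rw [Complex.ofReal_sub, ← gram_eq hk _ (fun i => (z i).2), ← gram_eq hℓ _ (fun i => (z i).2),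
      ← Finset.sum_sub_distrib]
    refine Finset.sum_congr rfl fun i _ => ?_
    rw [← Finset.sum_sub_distrib]
    refine Finset.sum_congr rfl fun j _ => ?_
    simp [dotProduct, mulVec, Matrix.mul_apply]
    ring
  constructor
  · intro h u
    have := h (fun i _ => u i)
    simp only [key] at this
    exact sub_nonneg.1 (Complex.zero_le_real.1 this)
  · intro h u
    simp only [key]
    exact Complex.zero_le_real.2 (sub_nonneg.2 (h _))

lemma riesz_abstract {X H : Type*} [NormedAddCommGroup H] [InnerProductSpace ℂ H] [CompleteSpace H]
    (v : X → H) (f : X → ℂ)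
    (hf : ∀ (n : ℕ) (z : Fin n → X) (c : Fin n → ℂ), ‖∑ j, c j * f (z j)‖ ≤ ‖∑ j, c j • v (z j)‖) :
    ∃ h : H, ‖h‖ ≤ 1 ∧ ∀ x, f x = inner ℂ h (v x) := by
  let T : (X →₀ ℂ) →ₗ[ℂ] H := Finsupp.linearCombination ℂ v
  let F : (X →₀ ℂ) →ₗ[ℂ] ℂ := Finsupp.linearCombination ℂ f
  have hb : ∀ c, ‖F c‖ ≤ ‖T c‖ := by
    intro c
    have := hf c.support.card (fun i => (c.support.equivFin.symm i : X))
      (fun i => c (c.support.equivFin.symm i : X))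
    have e1 : F c = ∑ j, c (c.support.equivFin.symm j : X) * f (c.support.equivFin.symm j : X) := by
      rw [Equiv.sum_comp c.support.equivFin.symm (fun x => c (x : X) * f x),
        Finset.sum_coe_sort c.support (fun x => c x * f x)]
      simp [F, Finsupp.linearCombination_apply, Finsupp.sum]
    have e2 : T c = ∑ j, c (c.support.equivFin.symm j : X) • v (c.support.equivFin.symm j : X) := by
      rw [Equiv.sum_comp c.support.equivFin.symm (fun x => c (x : X) • v x),
        Finset.sum_coe_sort c.support (fun x => c x • v x)]
      simp [T, Finsupp.linearCombination_apply, Finsupp.sum]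
    rw [e1, e2]; exact this
  have hker : ∀ c d, T c = T d → F c = F d := by
    intro c d h
    have := hb (c - d)
    rw [map_sub, map_sub, h, sub_self, norm_zero] at this
    exact sub_eq_zero.1 (norm_le_zero_iff.1 this)
  choose s hs using fun y : LinearMap.range T => y.2
  let φ : LinearMap.range T →ₗ[ℂ] ℂ :=
    { toFun := fun y => F (s y)
      map_add' := fun x y => by
        rw [← map_add]; apply hker; rw [map_add]; simp [hs]
      map_smul' := fun c x => by
        rw [RingHom.id_apply, ← map_smul]; apply hker; rw [map_smul]; simp [hs] }
  let ψ := φ.mkContinuous 1 (fun y => by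
    have := hb (s y)
    rw [hs y] at this
    simpa [φ] using this)
  obtain ⟨g, hg, hn⟩ := exists_extension_norm_eq (LinearMap.range T) ψ
  refine ⟨(InnerProductSpace.toDual ℂ H).symm g, ?_, fun x => ?_⟩
  · rw [LinearIsometryEquiv.norm_map, hn]
    exact LinearMap.mkContinuous_norm_le _ zero_le_one _
  · rw [InnerProductSpace.toDual_symm_apply]
    have hx : T (Finsupp.single x 1) = v x := by simp [T]
    have := hg ⟨v x, ⟨_, hx⟩⟩
    rw [this]
    change f x = F (s _)
    have e : F (Finsupp.single x 1) = f x := by simp [F]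
    rw [← e]
    apply hker
    rw [hs, hx]

lemma rkhs_repr {g : ℕ} {Ω : Set (Fin g → ℂ)} {ℓc : (Fin g → ℕ) → ℝ}
    (hℓ : IsNormalizedDiag Ω ℓc) (f : Ω → ℂ)
    (hf : ∀ (n : ℕ) (z : Fin n → Ω) (c : Fin n → ℂ),
      ‖∑ j, c j * (starRingEnd ℂ) (f (z j))‖ ^ 2 ≤ GG ℓc (fun i => (z i : Fin g → ℂ)) c) :
    ∃ h : (Fin g → ℕ) → ℂ, Summable (fun a => ‖h a‖ ^ 2) ∧ ∑' a, ‖h a‖ ^ 2 ≤ 1 ∧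
      ∀ z : Ω, HasSum (fun a => h a * (Real.sqrt (ℓc a) : ℂ) * mpow (z : Fin g → ℂ) a) (f z) := by
  have hmem : ∀ z : Ω, Memℓp (fun a : Fin g → ℕ => (Real.sqrt (ℓc a) : ℂ) *
      (starRingEnd ℂ) (mpow (z : Fin g → ℂ) a)) 2 := by
    intro z
    refine memℓp_gen ?_
    convert hℓ.2.2 z z.2 using 2 with a
    simp [mul_pow, Real.sq_sqrt (hℓ.2.1 a).le]
  let v : Ω → lp (fun _ : Fin g → ℕ => ℂ) 2 := fun z => ⟨_, hmem z⟩
  have hnsq : ∀ x : lp (fun _ : Fin g → ℕ => ℂ) 2, HasSum (fun a => ‖x a‖ ^ 2) (‖x‖ ^ 2) := by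
    intro x
    have := lp.hasSum_norm (p := 2) (by norm_num) x
    simpa using this
  obtain ⟨h, h1, h2⟩ := riesz_abstract v (fun z => (starRingEnd ℂ) (f z)) (by
    intro n z c
    refine (pow_le_pow_iff_left₀ (norm_nonneg _) (norm_nonneg _) two_ne_zero).1 ?_
    refine (hf n z c).trans (le_of_eq ?_)
    rw [← (hnsq _).tsum_eq, GG]
    refine tsum_congr fun a => ?_
    have : (∑ j, c j • v (z j)) a = (Real.sqrt (ℓc a) : ℂ) * Sg (fun i => (z i : Fin g → ℂ)) c a := by
      rw [lp.coeFn_sum, Finset.sum_apply, Sg, Finset.mul_sum]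
      refine Finset.sum_congr rfl fun j _ => ?_
      rw [lp.coeFn_smul, Pi.smul_apply, smul_eq_mul]
      simp only [v]
      ring
    rw [this]
    simp [mul_pow, Real.sq_sqrt (hℓ.2.1 a).le])
  refine ⟨h, (hnsq h).summable, ?_, fun z => ?_⟩
  · rw [(hnsq h).tsum_eq]; nlinarith [norm_nonneg h]
  · have := lp.hasSum_inner (𝕜 := ℂ) h (v z)
    rw [← h2 z] at this
    have := (Complex.hasSum_conj'.2 this)
    simp only [Complex.conj_conj] at this
    convert this using 2 with a
    simp [v]
    ring
def zet (M : ℕ) : ℂ := Complex.exp (2 * Real.pi * Complex.I / M)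

def chi {g : ℕ} (M : ℕ) (j : Fin g → Fin M) (a : Fin g → ℕ) : ℂ :=
  ∏ i, (zet M ^ (j i : ℕ)) ^ a i

def pt {g : ℕ} (r : ℝ) (M : ℕ) (j : Fin g → Fin M) : Fin g → ℂ :=
  fun i => (r : ℂ) * zet M ^ (j i : ℕ)

def od {g : ℕ} (a : Fin g → ℕ) : ℕ := ∑ i, a i

lemma od_add {g : ℕ} (a b : Fin g → ℕ) : od (a + b) = od a + od b := by
  simp [od, Finset.sum_add_distrib]

lemma zet_prim {M : ℕ} (hM : M ≠ 0) : IsPrimitiveRoot (zet M) M :=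
  Complex.isPrimitiveRoot_exp M hM

lemma zet_norm {M : ℕ} (hM : M ≠ 0) : ‖zet M‖ = 1 :=
  (zet_prim hM).norm'_eq_one hM

lemma mpow_pt {g : ℕ} (r : ℝ) (M : ℕ) (j : Fin g → Fin M) (a : Fin g → ℕ) :
    mpow (pt r M j) a = (r : ℂ) ^ od a * chi M j a := by
  simp [mpow, pt, chi, mul_pow, Finset.prod_mul_distrib, od, Finset.prod_pow_eq_pow_sum]

lemma chi_norm {g M : ℕ} (hM : M ≠ 0) (j : Fin g → Fin M) (a : Fin g → ℕ) :
    ‖chi M j a‖ = 1 := by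
  simp [chi, norm_prod, zet_norm hM]

lemma chi_add {g M : ℕ} (j : Fin g → Fin M) (a b : Fin g → ℕ) :
    chi M j (a + b) = chi M j a * chi M j b := by
  simp [chi, pow_add, Finset.prod_mul_distrib]

lemma chi_conj_mul {g M : ℕ} (hM : M ≠ 0) (j : Fin g → Fin M) (a : Fin g → ℕ) :
    (starRingEnd ℂ) (chi M j a) * chi M j a = 1 := by
  rw [Complex.conj_mul', chi_norm hM]; simp

lemma chi_mod {g M : ℕ} (hM : M ≠ 0) (j : Fin g → Fin M) (a : Fin g → ℕ) :
    chi M j (fun i => a i % M) = chi M j a := by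
  refine Finset.prod_congr rfl fun i _ => ?_
  have : (zet M ^ (j i : ℕ)) ^ M = 1 := by
    rw [← pow_mul, mul_comm, pow_mul, (zet_prim hM).pow_eq_one, one_pow]
  exact (pow_eq_pow_mod _ this).symm

lemma sum_one {M : ℕ} (hM : M ≠ 0) (c d : ℕ) :
    ∑ t : Fin M, (starRingEnd ℂ) ((zet M ^ (t : ℕ)) ^ d) * (zet M ^ (t : ℕ)) ^ c =
      if c ≡ d [MOD M] then (M : ℂ) else 0 := by
  have hz := zet_prim hM
  have hn : (starRingEnd ℂ) (zet M) * zet M = 1 := by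
    rw [Complex.conj_mul', zet_norm hM]; simp
  set q : ℂ := (starRingEnd ℂ) (zet M) ^ d * zet M ^ c with hq
  have e : ∀ t : ℕ, (starRingEnd ℂ) ((zet M ^ t) ^ d) * (zet M ^ t) ^ c = q ^ t := by
    intro t
    rw [hq, map_pow, map_pow, mul_pow, ← pow_mul, ← pow_mul, ← pow_mul, ← pow_mul]
    ring
  simp only [e]
  rw [Fin.sum_univ_eq_sum_range (fun t => q ^ t) M]
  have hqd : q * zet M ^ d = zet M ^ c := by
    rw [hq, mul_right_comm, ← mul_pow, hn, one_pow, one_mul]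
  have hfin : IsOfFinOrder (zet M) := isOfFinOrder_iff_pow_eq_one.2 ⟨M, Nat.pos_of_ne_zero hM, hz.pow_eq_one⟩
  have hiff : zet M ^ c = zet M ^ d ↔ c ≡ d [MOD M] := by
    rw [hfin.pow_eq_pow_iff_modEq, ← hz.eq_orderOf]
  have hz0 : zet M ^ d ≠ 0 := pow_ne_zero _ (hz.ne_zero hM)
  split_ifs with h
  · have : q = 1 := by
      rw [← hiff] at h
      rw [h] at hqd
      exact mul_right_cancel₀ hz0 (by rw [hqd, one_mul])
    simp [this]
  · have h1 : q ≠ 1 := by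
      rintro h1
      rw [h1, one_mul] at hqd
      exact h (hiff.1 hqd.symm)
    have hqM : q ^ M = 1 := by
      rw [hq, mul_pow, ← pow_mul, ← pow_mul, mul_comm d, mul_comm c, pow_mul, pow_mul,
        ← map_pow, hz.pow_eq_one]
      simp
    have := geom_sum_mul q M
    rw [hqM, sub_self] at this
    exact (mul_eq_zero.1 this).resolve_right (sub_ne_zero.2 h1)

lemma sum_chi {g M : ℕ} (hM : M ≠ 0) (c d : Fin g → ℕ) :
    ∑ j : Fin g → Fin M, (starRingEnd ℂ) (chi M j d) * chi M j c =
      if ∀ i, c i ≡ d i [MOD M] then (M : ℂ) ^ g else 0 := by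
  have : ∀ j : Fin g → Fin M, (starRingEnd ℂ) (chi M j d) * chi M j c =
      ∏ i, ((starRingEnd ℂ) ((zet M ^ (j i : ℕ)) ^ d i) * (zet M ^ (j i : ℕ)) ^ c i) := by
    intro j
    rw [Finset.prod_mul_distrib, chi, chi, map_prod]
  simp only [this]
  rw [← Fintype.prod_sum (fun i (t : Fin M) =>
    (starRingEnd ℂ) ((zet M ^ (t : ℕ)) ^ d i) * (zet M ^ (t : ℕ)) ^ c i)]
  simp only [sum_one hM]
  split_ifs with h
  · simp [h]
  · push Not at h
    obtain ⟨i, hi⟩ := h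
    exact Finset.prod_eq_zero (Finset.mem_univ i) (by simp [hi])

def avg {g : ℕ} (M : ℕ) (d : Fin g → ℕ) (F : (Fin g → Fin M) → ℂ) : ℂ :=
  ((M : ℂ) ^ g)⁻¹ * ∑ j, (starRingEnd ℂ) (chi M j d) * F j

lemma avg_hasSum {g M : ℕ} (hM : M ≠ 0) (d : Fin g → ℕ) (F : (Fin g → Fin M) → ℂ)
    (w : (Fin g → ℕ) → ℂ) (h : ∀ j, HasSum (fun c => w c * chi M j c) (F j)) :
    HasSum (fun c => if ∀ i, c i ≡ d i [MOD M] then w c else 0) (avg M d F) := by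
  have h1 : HasSum (fun c => ((M : ℂ) ^ g)⁻¹ *
      ∑ j, (starRingEnd ℂ) (chi M j d) * (w c * chi M j c)) (avg M d F) :=
    (hasSum_sum fun j _ => (h j).mul_left _).mul_left _
  convert h1 using 2 with c
  have : ∑ j, (starRingEnd ℂ) (chi M j d) * (w c * chi M j c) =
      w c * ∑ j, (starRingEnd ℂ) (chi M j d) * chi M j c := by
    rw [Finset.mul_sum]
    exact Finset.sum_congr rfl fun j _ => by ring
  rw [this, sum_chi hM]
  have hM' : (M : ℂ) ^ g ≠ 0 := pow_ne_zero _ (Nat.cast_ne_zero.2 hM)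
  split_ifs
  · field_simp
  · simp

open Filter Topology in
lemma avg_tendsto {g : ℕ} (d : Fin g → ℕ) (F : ∀ M : ℕ, (Fin g → Fin M) → ℂ)
    (w : (Fin g → ℕ) → ℂ) (hw : Summable fun c => ‖w c‖)
    (h : ∀ M j, HasSum (fun c => w c * chi M j c) (F M j)) :
    Tendsto (fun M => avg M d (F M)) atTop (𝓝 (w d)) := by
  have key : Tendsto (fun M : ℕ => ∑' c : Fin g → ℕ, if ∀ i, c i ≡ d i [MOD M] then w c else 0) atTop
      (𝓝 (∑' c, if c = d then w c else 0)) := by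
    refine tendsto_tsum_of_dominated_convergence hw (fun c => ?_) (Eventually.of_forall fun M c => ?_)
    · refine tendsto_const_nhds.congr' ?_
      filter_upwards [eventually_gt_atTop (od c + od d)] with M hM
      have : (∀ i, c i ≡ d i [MOD M]) ↔ c = d := by
        constructor
        · intro h
          funext i
          have h1 : c i ≤ od c := Finset.single_le_sum (f := c) (fun _ _ => Nat.zero_le _) (Finset.mem_univ i)
          have h2 : d i ≤ od d := Finset.single_le_sum (f := d) (fun _ _ => Nat.zero_le _) (Finset.mem_univ i)
          exact Nat.ModEq.eq_of_lt_of_lt (h i) (by omega) (by omega)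
        · rintro rfl i; exact Nat.ModEq.refl _
      simp [this]
    · split_ifs <;> simp
  rw [tsum_ite_eq] at key
  refine key.congr' ?_
  filter_upwards [eventually_ne_atTop 0] with M hM
  exact (avg_hasSum hM d (F M) w (h M)).tsum_eq

lemma Sg_shift {g n : ℕ} (z : Fin n → Fin g → ℂ) (u : Fin n → ℂ) (e : ℂ) (a b : Fin g → ℕ) :
    Sg z (fun j => u j * (starRingEnd ℂ) (e * mpow (z j) b)) a =
      (starRingEnd ℂ) e * Sg z u (a + b) := by
  simp only [Sg, mpow_add', map_mul, Finset.mul_sum]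
  exact Finset.sum_congr rfl fun j _ => by ring

lemma pick_data {g : ℕ} {Ω : Set (Fin g → ℂ)} {kc ℓc : (Fin g → ℕ) → ℝ}
    (hk : IsNormalizedDiag Ω kc) (hℓ : IsNormalizedDiag Ω ℓc) {ρ : ℝ} (hρ : 0 < ρ) (hρ1 : ρ ≤ 1)
    (hmem : ∀ r : ℝ, 0 < r → r ≤ ρ → ∀ M (j : Fin g → Fin M), pt r M j ∈ Ω)
    (hsum : Summable fun a => kc a * (ρ ^ od a) ^ 2)
    {M : ℕ} (hM : M ≠ 0) (b : Fin g → ℕ) :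
    ∃ ε : ℝ, 0 < ε ∧ ∀ r : ℝ, 0 < r → r ≤ ρ → ∀ (n : ℕ) (e : Fin n → (Fin g → Fin M)) (u : Fin n → ℂ),
      GG kc (fun i => pt r M (e i))
        (fun j => u j * (starRingEnd ℂ) ((ε : ℂ) * mpow (pt r M (e j)) b))
      ≤ GG ℓc (fun i => pt r M (e i)) u := by
  set box := Fintype.piFinset (fun _ : Fin g => Finset.range M) with hbox
  set Λ := ∑ m ∈ box, (ℓc m)⁻¹ with hΛ
  set K := ∑' a, kc a * (ρ ^ od a) ^ 2 with hK
  have hΛpos : 0 < Λ := by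
    refine Finset.sum_pos (fun m _ => inv_pos.2 (hℓ.2.1 m)) ⟨0, ?_⟩
    simp [hbox, Nat.pos_of_ne_zero hM]
  have hKpos : 0 < K := by
    refine hsum.tsum_pos (fun a => ?_) 0 ?_
    · have := hk.2.1 a; positivity
    · have := hk.2.1 0; positivity
  set A := K * ((ρ ^ (g * M))⁻¹) ^ 2 * Λ with hA
  have hApos : 0 < A := by positivity
  refine ⟨Real.sqrt A⁻¹, by positivity, fun r hr hrρ n e u => ?_⟩
  set z : Fin n → Fin g → ℂ := fun i => pt r M (e i) with hz
  have hzΩ : ∀ i, z i ∈ Ω := fun i => hmem r hr hrρ M (e i)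
  set Q := GG ℓc z u with hQ
  have hsumQ := gram_hasSum_real hℓ z hzΩ u
  have hQ0 : 0 ≤ Q := hsumQ.nonneg fun a => by have := hℓ.2.1 a; positivity
  have hS : ∀ a, Sg z u a = (r : ℂ) ^ od a * ∑ j, u j * (starRingEnd ℂ) (chi M (e j) a) := by
    intro a
    simp only [Sg, hz, mpow_pt, Finset.mul_sum, map_mul, map_pow, Complex.conj_ofReal]
    exact Finset.sum_congr rfl fun j _ => by ring
  have hterm : ∀ a, ‖Sg z u (a + b)‖ ^ 2 ≤ (ρ ^ od a) ^ 2 * ((ρ ^ (g * M))⁻¹) ^ 2 * (Λ * Q) := by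
    intro a
    set m : Fin g → ℕ := fun i => (a + b) i % M with hm
    have hmbox : m ∈ box := by
      simp [hbox, hm, Nat.mod_lt _ (Nat.pos_of_ne_zero hM)]
    have hle : od m ≤ od (a + b) := Finset.sum_le_sum fun i _ => Nat.mod_le _ _
    have hle2 : od m ≤ g * M := by
      have : od m ≤ ∑ _i : Fin g, M :=
        Finset.sum_le_sum fun i _ => (Nat.mod_lt _ (Nat.pos_of_ne_zero hM)).le
      simpa using this
    have h1 : Sg z u (a + b) = (r : ℂ) ^ (od (a + b) - od m) * Sg z u m := by
      rw [hS, hS, ← mul_assoc, ← pow_add, Nat.sub_add_cancel hle]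
      simp only [hm, chi_mod hM]
    have h2 : ‖Sg z u m‖ ^ 2 ≤ Λ * Q := by
      have h3 : ℓc m * ‖Sg z u m‖ ^ 2 ≤ Q :=
        le_hasSum hsumQ m fun a _ => by have := hℓ.2.1 a; positivity
      have h4 : (ℓc m)⁻¹ ≤ Λ :=
        Finset.single_le_sum (f := fun m => (ℓc m)⁻¹) (fun m _ => (inv_pos.2 (hℓ.2.1 m)).le) hmbox
      have h5 := hℓ.2.1 m
      calc ‖Sg z u m‖ ^ 2 = (ℓc m)⁻¹ * (ℓc m * ‖Sg z u m‖ ^ 2) := by field_simp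
        _ ≤ Λ * Q := by gcongr
    have h6 : r ^ (od (a + b) - od m) ≤ ρ ^ od a * (ρ ^ (g * M))⁻¹ := by
      rw [← div_eq_mul_inv, le_div_iff₀ (by positivity)]
      calc r ^ (od (a + b) - od m) * ρ ^ (g * M) ≤ ρ ^ (od (a + b) - od m) * ρ ^ od m := by
            gcongr ?_ * ?_
            · exact pow_le_pow_left₀ hr.le hrρ _
            · exact pow_le_pow_of_le_one hρ.le hρ1 hle2
        _ = ρ ^ od (a + b) := by rw [← pow_add, Nat.sub_add_cancel hle]
        _ ≤ ρ ^ od a := pow_le_pow_of_le_one hρ.le hρ1 (by rw [od_add]; omega)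
    rw [h1, norm_mul, norm_pow, Complex.norm_real, Real.norm_eq_abs, abs_of_pos hr, mul_pow, ← mul_pow (ρ ^ od a)]
    gcongr
  have hs2 := gram_hasSum_real hk z hzΩ (fun j => u j * (starRingEnd ℂ) ((Real.sqrt A⁻¹ : ℂ) * mpow (z j) b))
  have hs3 := hsum.hasSum.mul_right (A⁻¹ * ((ρ ^ (g * M))⁻¹) ^ 2 * (Λ * Q))
  refine (hasSum_le (fun a => ?_) hs2 hs3).trans (le_of_eq ?_)
  · rw [Sg_shift, norm_mul, mul_pow, Complex.conj_ofReal, Complex.norm_real, Real.norm_eq_abs, sq_abs, Real.sq_sqrt (by positivity)]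
    have := hk.2.1 a
    calc kc a * (A⁻¹ * ‖Sg z u (a + b)‖ ^ 2) ≤ kc a * (A⁻¹ * ((ρ ^ od a) ^ 2 * ((ρ ^ (g * M))⁻¹) ^ 2 * (Λ * Q))) := by
          gcongr; exact hterm a
      _ = _ := by ring
  · rw [← hK]
    calc K * (A⁻¹ * ((ρ ^ (g * M))⁻¹) ^ 2 * (Λ * Q)) = A⁻¹ * A * Q := by rw [hA]; ring
      _ = Q := by rw [inv_mul_cancel₀ hApos.ne', one_mul]

lemma final_pos {g : ℕ} {Ω : Set (Fin g → ℂ)} {kc ℓc : (Fin g → ℕ) → ℝ}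
    (hk : IsNormalizedDiag Ω kc) (hℓ : IsNormalizedDiag Ω ℓc) (b : Fin g → ℕ) (C : ℝ) (hC : 0 < C)
    (h : ∀ a, kc a ≤ C * ℓc (a + b)) :
    IsPosKernel (fun z w : Ω =>
        (C : ℂ) * diagKer ℓc ↑z ↑w - mpow ↑z b * (starRingEnd ℂ) (mpow ↑w b) * diagKer kc ↑z ↑w) := by
  intro n z c
  have e : ∑ i, ∑ j, (starRingEnd ℂ) (c i) * c j * ((C : ℂ) * diagKer ℓc (z i) (z j) -
      mpow (z i) b * (starRingEnd ℂ) (mpow (z j) b) * diagKer kc (z i) (z j)) =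
      ((C * GG ℓc (fun i => (z i : Fin g → ℂ)) c - GG kc (fun i => (z i : Fin g → ℂ))
        (fun j => c j * (starRingEnd ℂ) (1 * mpow (z j : Fin g → ℂ) b)) : ℝ) : ℂ) := by
    rw [Complex.ofReal_sub, Complex.ofReal_mul, ← gram_eq hk _ (fun i => (z i).2),
      ← gram_eq hℓ _ (fun i => (z i).2), Finset.mul_sum, ← Finset.sum_sub_distrib]
    refine Finset.sum_congr rfl fun i _ => ?_
    rw [Finset.mul_sum, ← Finset.sum_sub_distrib]
    refine Finset.sum_congr rfl fun j _ => ?_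
    simp
    ring
  rw [e]
  refine Complex.zero_le_real.2 (sub_nonneg.2 ?_)
  have h1 := gram_hasSum_real hℓ (fun i => (z i : Fin g → ℂ)) (fun i => (z i).2) c
  have h2 := gram_hasSum_real hk (fun i => (z i : Fin g → ℂ)) (fun i => (z i).2)
    (fun j => c j * (starRingEnd ℂ) (1 * mpow (z j : Fin g → ℂ) b))
  refine hasSum_le_inj (fun a => a + b) (add_left_injective b) (fun a _ => ?_) (fun a => ?_) h2 (h1.mul_left C)
  · have := hℓ.2.1 a; positivity
  · rw [Sg_shift]
    simp only [map_one, one_mul, ← mul_assoc]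
    gcongr
    exact h a
end aux

/-- For a complete Pick pair `(k, ℓ)` of normalized diagonal holomorphic kernels on `Ω`,
every monomial is a bounded multiplier from `H_k` to `H_ℓ`: for every `b` there is
`C > 0` with `C·ℓ(z,w) − z^b·conj(w^b)·k(z,w)` a positive kernel on `Ω`. -/
theorem diag_monomial_multiplier {g : ℕ} (hg : 1 ≤ g)
    (Ω : Set (Fin g → ℂ)) (hΩo : IsOpen Ω) (hΩc : IsConnected Ω)
    (h0 : (0 : Fin g → ℂ) ∈ Ω)
    (kc ℓc : (Fin g → ℕ) → ℝ)
    (hk : IsNormalizedDiag Ω kc) (hℓ : IsNormalizedDiag Ω ℓc)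
    (hCP : IsCompletePickPair (fun z w : Ω => diagKer kc ↑z ↑w)
      (fun z w : Ω => diagKer ℓc ↑z ↑w)) :
    ∀ b : Fin g → ℕ, ∃ C : ℝ, 0 < C ∧
      IsPosKernel (fun z w : Ω =>
        (C : ℂ) * diagKer ℓc ↑z ↑w - mpow ↑z b * (starRingEnd ℂ) (mpow ↑w b) * diagKer kc ↑z ↑w) := by
  intro b
  obtain ⟨δ, hδ, hball⟩ := Metric.isOpen_iff.1 hΩo 0 h0
  set ρ : ℝ := min 1 (δ / 2) with hρdef
  have hρ : 0 < ρ := lt_min one_pos (by linarith)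
  have hρ1 : ρ ≤ 1 := min_le_left _ _
  have hρδ : ρ < δ := lt_of_le_of_lt (min_le_right _ _) (by linarith)
  have hmem : ∀ r : ℝ, 0 < r → r ≤ ρ → ∀ M (j : Fin g → Fin M), pt r M j ∈ Ω := by
    intro r hr hrρ M j
    apply hball
    rw [mem_ball_zero_iff, pi_norm_lt_iff hδ]
    intro i
    have hM : M ≠ 0 := fun h => by subst h; exact (j i).elim0
    simp only [pt, norm_mul, norm_pow, zet_norm hM, one_pow, mul_one, Complex.norm_real,
      Real.norm_eq_abs, abs_of_pos hr]
    linarith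
  have hsum : ∀ {c : (Fin g → ℕ) → ℝ}, IsNormalizedDiag Ω c →
      Summable fun a => c a * (ρ ^ od a) ^ 2 := by
    intro c hc
    have := hc.2.2 _ (hmem ρ hρ le_rfl 1 (fun _ => 0))
    convert this using 3 with a
    rw [mpow_pt, norm_mul, chi_norm one_ne_zero, norm_pow, Complex.norm_real, Real.norm_eq_abs,
      abs_of_pos hρ, mul_one]
  set M := od b + 1 with hMdef
  have hM : M ≠ 0 := by omega
  obtain ⟨ε, hε, hpick⟩ := pick_data hk hℓ hρ hρ1 hmem (hsum hk) hM b
  set L := ∑' a, ℓc a * (ρ ^ od a) ^ 2 with hL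
  have hL0 : 0 ≤ L := tsum_nonneg fun a => by have := hℓ.2.1 a; positivity
  set t : ℝ := min 1 (ε * ρ ^ od b / (2 * (1 + L))) with htdef
  have ht : 0 < t := lt_min one_pos (by positivity)
  have ht1 : t ≤ 1 := min_le_left _ _
  have ht2 : t * (1 + L) < ε * ρ ^ od b := by
    have h1 : t ≤ ε * ρ ^ od b / (2 * (1 + L)) := min_le_right _ _
    rw [le_div_iff₀ (by positivity)] at h1
    have : 0 < ε * ρ ^ od b := by positivity
    nlinarith
  set r := t * ρ with hr
  have hr0 : 0 < r := by positivity
  have hrρ : r ≤ ρ := by nlinarith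
  let e := (Fintype.equivFin (Fin g → Fin M)).symm
  have hn : 1 ≤ Fintype.card (Fin g → Fin M) := by
    have : Nonempty (Fin g → Fin M) := ⟨fun _ => ⟨0, by omega⟩⟩
    exact Fintype.card_pos
  obtain ⟨Φ, hΦ, hΦW⟩ := hCP _ 1 hn le_rfl (fun i => ⟨pt r M (e i), hmem r hr0 hrρ M _⟩)
    (fun i _ _ => (ε : ℂ) * mpow (pt r M (e i)) b)
    ((pick_iff hk hℓ _ _).2 fun u => hpick r hr0 hrρ _ e u)
  set φ : Ω → ℂ := fun z => Φ z 0 0 with hφ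
  have hφv : ∀ j, φ ⟨pt r M j, hmem r hr0 hrρ M j⟩ = (ε : ℂ) * mpow (pt r M j) b := by
    intro j
    have := hΦW (e.symm j)
    simp only [Equiv.apply_symm_apply] at this
    simp only [hφ, this]
  have hmul : ∀ (n : ℕ) (z : Fin n → Ω) (u : Fin n → ℂ),
      GG kc (fun i => (z i : Fin g → ℂ)) (fun j => u j * (starRingEnd ℂ) (φ (z j)))
        ≤ GG ℓc (fun i => (z i : Fin g → ℂ)) u := fun n z =>
    (pick_iff hk hℓ z _).1 (hΦ n z)
  have hrep : ∀ a : Fin g → ℕ, ∃ h : (Fin g → ℕ) → ℂ, Summable (fun c => ‖h c‖ ^ 2) ∧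
      ∑' c, ‖h c‖ ^ 2 ≤ 1 ∧ ∀ z : Ω, HasSum (fun c => h c * (Real.sqrt (ℓc c) : ℂ) *
        mpow (z : Fin g → ℂ) c) ((Real.sqrt (kc a) : ℂ) * mpow (z : Fin g → ℂ) a * φ z) := by
    intro a
    refine rkhs_repr hℓ _ fun n z c => le_trans ?_ (hmul n z c)
    have h1 := gram_hasSum_real hk (fun i => (z i : Fin g → ℂ)) (fun i => (z i).2)
      (fun j => c j * (starRingEnd ℂ) (φ (z j)))
    refine le_trans (le_of_eq ?_) (le_hasSum h1 a fun d _ => by have := hk.2.1 d; positivity)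
    have h2 : ∑ j, c j * (starRingEnd ℂ) ((Real.sqrt (kc a) : ℂ) * mpow (z j : Fin g → ℂ) a * φ (z j))
        = (Real.sqrt (kc a) : ℂ) * Sg (fun i => (z i : Fin g → ℂ))
          (fun j => c j * (starRingEnd ℂ) (φ (z j))) a := by
      simp only [Sg, Finset.mul_sum, map_mul, Complex.conj_ofReal]
      exact Finset.sum_congr rfl fun j _ => by ring
    rw [h2, norm_mul, mul_pow, Complex.norm_real, Real.norm_eq_abs, sq_abs,
      Real.sq_sqrt (hk.2.1 a).le]
  -- summability of coefficients at radius `ρ`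
  have hcoef : ∀ h : (Fin g → ℕ) → ℂ, ∀ c, ‖h c * (Real.sqrt (ℓc c) : ℂ) * (ρ : ℂ) ^ od c‖ ≤
      ‖h c‖ ^ 2 + ℓc c * (ρ ^ od c) ^ 2 := by
    intro h c
    rw [norm_mul, norm_mul, norm_pow, Complex.norm_real, Complex.norm_real, Real.norm_eq_abs,
      Real.norm_eq_abs, abs_of_pos hρ, abs_of_nonneg (Real.sqrt_nonneg _), mul_assoc]
    have e1 : ℓc c * (ρ ^ od c) ^ 2 = (Real.sqrt (ℓc c) * ρ ^ od c) ^ 2 := by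
      rw [mul_pow, Real.sq_sqrt (hℓ.2.1 c).le]
    rw [e1]
    nlinarith [sq_nonneg (‖h c‖ - Real.sqrt (ℓc c) * ρ ^ od c), sq_nonneg ‖h c‖,
      sq_nonneg (Real.sqrt (ℓc c) * ρ ^ od c)]
  obtain ⟨h, hs, hs1, hh⟩ := hrep 0
  have hh' : ∀ z : Ω, HasSum (fun c => h c * (Real.sqrt (ℓc c) : ℂ) *
        mpow (z : Fin g → ℂ) c) (φ z) := by
    intro z
    have := hh z
    rw [hk.1] at this
    simpa [mpow] using this
  have hb0 : h b ≠ 0 := by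
    intro hb
    have h1 := avg_hasSum hM b (fun j => φ ⟨pt r M j, hmem r hr0 hrρ M j⟩)
      (fun c => h c * (Real.sqrt (ℓc c) : ℂ) * (r : ℂ) ^ od c) (fun j => by
        convert hh' ⟨pt r M j, hmem r hr0 hrρ M j⟩ using 2 with c
        rw [mpow_pt]; ring)
    have h2 : avg M b (fun j => φ ⟨pt r M j, hmem r hr0 hrρ M j⟩) = (ε : ℂ) * (r : ℂ) ^ od b := by
      simp only [avg, hφv, mpow_pt]
      have : ∀ j : Fin g → Fin M, (starRingEnd ℂ) (chi M j b) * ((ε : ℂ) * ((r : ℂ) ^ od b * chi M j b))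
          = (ε : ℂ) * (r : ℂ) ^ od b := by
        intro j
        linear_combination ((ε : ℂ) * (r : ℂ) ^ od b) * chi_conj_mul hM j b
      simp only [this, Finset.sum_const, Finset.card_univ, Fintype.card_fun, Fintype.card_fin,
        nsmul_eq_mul]
      have hM' : (M : ℂ) ^ g ≠ 0 := pow_ne_zero _ (Nat.cast_ne_zero.2 hM)
      rw [Nat.cast_pow, inv_mul_cancel_left₀ hM']
    rw [h2] at h1
    have h3 : HasSum (fun c => t ^ (od b + 1) * (‖h c‖ ^ 2 + ℓc c * (ρ ^ od c) ^ 2))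
        (t ^ (od b + 1) * (∑' c, ‖h c‖ ^ 2 + L)) :=
      (hs.hasSum.add (hsum hℓ).hasSum).mul_left _
    have h4 : ‖(ε : ℂ) * (r : ℂ) ^ od b‖ ≤ t ^ (od b + 1) * (∑' c, ‖h c‖ ^ 2 + L) := by
      rw [← h1.tsum_eq]
      refine tsum_of_norm_bounded h3 fun c => ?_
      have hpos : 0 ≤ t ^ (od b + 1) * (‖h c‖ ^ 2 + ℓc c * (ρ ^ od c) ^ 2) := by
        have := hℓ.2.1 c; positivity
      split_ifs with hc
      · by_cases hcb : c = b
        · rw [hcb, hb]; simpa [hcb, hb] using hpos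
        · have hod : od b + 1 ≤ od c := by
            have hle : ∀ i, b i ≤ c i := by
              intro i
              have h5 : b i ≤ od b := Finset.single_le_sum (f := b) (fun _ _ => Nat.zero_le _) (Finset.mem_univ i)
              have h6 := hc i
              rw [Nat.ModEq, Nat.mod_eq_of_lt (show b i < M by omega)] at h6
              rw [← h6]; exact Nat.mod_le _ _
            obtain ⟨i, hi⟩ := Function.ne_iff.1 hcb
            exact Finset.sum_lt_sum (fun i _ => hle i) ⟨i, Finset.mem_univ i, lt_of_le_of_ne (hle i) (Ne.symm hi)⟩
          have e2 : h c * (Real.sqrt (ℓc c) : ℂ) * (r : ℂ) ^ od c =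
              (t : ℂ) ^ od c * (h c * (Real.sqrt (ℓc c) : ℂ) * (ρ : ℂ) ^ od c) := by
            rw [hr]; push_cast; ring
          rw [e2, norm_mul, norm_pow, Complex.norm_real, Real.norm_eq_abs, abs_of_pos ht]
          exact mul_le_mul (pow_le_pow_of_le_one ht.le ht1 hod) (hcoef h c) (norm_nonneg _) (by positivity)
      · simpa using hpos
    rw [norm_mul, norm_pow, Complex.norm_real, Complex.norm_real, Real.norm_eq_abs,
      Real.norm_eq_abs, abs_of_pos hε, abs_of_pos hr0, hr, mul_pow, pow_succ] at h4
    have h5 : t ^ od b * (ε * ρ ^ od b) ≤ t ^ od b * (t * (1 + L)) := by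
      calc _ = ε * (t ^ od b * ρ ^ od b) := by ring
        _ ≤ t ^ od b * t * (∑' c, ‖h c‖ ^ 2 + L) := h4
        _ ≤ t ^ od b * t * (1 + L) := by gcongr
        _ = _ := by ring
    have h6 := le_of_mul_le_mul_left h5 (by positivity)
    linarith
  -- the coefficient inequality
  have hineq : ∀ a, kc a * ‖h b * (Real.sqrt (ℓc b) : ℂ)‖ ^ 2 ≤ ℓc (a + b) := by
    intro a
    obtain ⟨h', hs', hs1', hh''⟩ := hrep a
    have T1 := avg_tendsto b (fun M j => φ ⟨pt ρ M j, hmem ρ hρ le_rfl M j⟩)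
      (fun c => h c * (Real.sqrt (ℓc c) : ℂ) * (ρ : ℂ) ^ od c)
      (Summable.of_nonneg_of_le (fun _ => norm_nonneg _) (hcoef h) (hs.add (hsum hℓ)))
      (fun M j => by
        convert hh' ⟨pt ρ M j, hmem ρ hρ le_rfl M j⟩ using 2 with c
        rw [mpow_pt]; ring)
    have T2 := avg_tendsto (a + b) (fun M j => (Real.sqrt (kc a) : ℂ) * mpow (pt ρ M j) a *
        φ ⟨pt ρ M j, hmem ρ hρ le_rfl M j⟩)
      (fun c => h' c * (Real.sqrt (ℓc c) : ℂ) * (ρ : ℂ) ^ od c)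
      (Summable.of_nonneg_of_le (fun _ => norm_nonneg _) (hcoef h') (hs'.add (hsum hℓ)))
      (fun M j => by
        convert hh'' ⟨pt ρ M j, hmem ρ hρ le_rfl M j⟩ using 2 with c
        rw [mpow_pt]; ring)
    have T3 := T1.const_mul ((Real.sqrt (kc a) : ℂ) * (ρ : ℂ) ^ od a)
    have T4 := T3.congr' (f₂ := fun M => avg M (a + b) (fun j => (Real.sqrt (kc a) : ℂ) *
        mpow (pt ρ M j) a * φ ⟨pt ρ M j, hmem ρ hρ le_rfl M j⟩)) (by
      filter_upwards [Filter.eventually_ne_atTop 0] with M' hM'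
      simp only [avg, mpow_pt, chi_add, map_mul, Finset.mul_sum]
      refine Finset.sum_congr rfl fun j _ => ?_
      linear_combination (-((Real.sqrt (kc a) : ℂ) * (ρ : ℂ) ^ od a) * ((M' : ℂ) ^ g)⁻¹ *
        (starRingEnd ℂ) (chi M' j b) * φ ⟨pt ρ M' j, hmem ρ hρ le_rfl M' j⟩) * chi_conj_mul hM' j a)
    have E := tendsto_nhds_unique T4 T2
    rw [od_add, pow_add] at E
    have hρc : (ρ : ℂ) ^ od a * (ρ : ℂ) ^ od b ≠ 0 := by
      have : (ρ : ℂ) ≠ 0 := Complex.ofReal_ne_zero.2 hρ.ne'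
      positivity
    have E2 : (Real.sqrt (kc a) : ℂ) * (h b * (Real.sqrt (ℓc b) : ℂ)) =
        h' (a + b) * (Real.sqrt (ℓc (a + b)) : ℂ) := by
      refine mul_right_cancel₀ hρc ?_
      linear_combination E
    have E3 : kc a * ‖h b * (Real.sqrt (ℓc b) : ℂ)‖ ^ 2 = ‖h' (a + b)‖ ^ 2 * ℓc (a + b) := by
      have := congrArg (fun x => ‖x‖ ^ 2) E2
      simp only [norm_mul (Real.sqrt (kc a) : ℂ), norm_mul (h' (a + b)), mul_pow, Complex.norm_real,
        Real.norm_eq_abs, sq_abs, Real.sq_sqrt (hk.2.1 a).le, Real.sq_sqrt (hℓ.2.1 (a + b)).le] at this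
      exact this
    have E4 : ‖h' (a + b)‖ ^ 2 ≤ 1 :=
      (hs'.le_tsum (a + b) fun _ _ => by positivity).trans hs1'
    rw [E3]
    exact mul_le_of_le_one_left (hℓ.2.1 _).le E4
  have hne : h b * (Real.sqrt (ℓc b) : ℂ) ≠ 0 :=
    mul_ne_zero hb0 (Complex.ofReal_ne_zero.2 (Real.sqrt_pos.2 (hℓ.2.1 b)).ne')
  have hnp : 0 < ‖h b * (Real.sqrt (ℓc b) : ℂ)‖ ^ 2 := by positivity
  refine ⟨(‖h b * (Real.sqrt (ℓc b) : ℂ)‖ ^ 2)⁻¹, inv_pos.2 hnp,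
    final_pos hk hℓ b _ (inv_pos.2 hnp) fun a => ?_⟩
  rw [← div_eq_inv_mul, le_div_iff₀ hnp]
  exact hineq a
end
end
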